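/- arXiv:1307.0369 — 3 statements merged into one kernel-verified Lean document; each statement's English description precedes it below -/
import Mathlib

section
/- Let (R, m, k) be a Cohen–Macaulay commutative noetherian local ring that contains a field. Then R has only finitely many semidualizing modules up to isomorphism, i.e., |𝔖₀(R)| < ∞. -/
/-!
STATEMENT 4: A Cohen–Macaulay commutative noetherian local ring containing a field
has only finitely many semidualizing modules up to isomorphism.
-/

open CategoryTheory

/-- `Ext^i_R(M, N)` for `R`-modules `M`, `N`. -/
noncomputable def extMod (R : Type) [CommRing R] (M N : ModuleCat R) (i : ℕ) : ModuleCat R :=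
  ((Ext R (ModuleCat R) i).obj (Opposite.op M)).obj N

/-- A finitely generated `R`-module `C` is semidualizing if the homothety map
`R → Hom_R(C, C)` is bijective and `Ext^i_R(C, C) = 0` for all `i ≥ 1`. -/
def IsSemidualizing (R : Type) [CommRing R] (C : Type) [AddCommGroup C] [Module R C] :
    Prop :=
  Module.Finite R C ∧
    Function.Bijective (LinearMap.lsmul R C) ∧
    ∀ i : ℕ, 1 ≤ i → Subsingleton (extMod R (ModuleCat.of R C) (ModuleCat.of R C) i)

/-- A noetherian local ring is Cohen–Macaulay when `depth R = dim R`; since always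
`depth R ≤ dim R`, this is equivalent to: the Krull dimension is some `d : ℕ` and
`Ext^i_R(k, R) = 0` for `i < d` (i.e. `depth R ≥ d`), where `k` is the residue field. -/
def IsCohenMacaulayLocal (R : Type) [CommRing R] [IsLocalRing R] : Prop :=
  ∃ d : ℕ, ringKrullDim R = d ∧
    ∀ i : ℕ, i < d →
      Subsingleton
        (extMod R (ModuleCat.of R (IsLocalRing.ResidueField R)) (ModuleCat.of R R) i)


open Polynomial in
/-- A square-zero extension of a field of positive characteristic splits. -/
theorem exists_section_of_square_zero {E K : Type*} [CommRing E] [Field K] (p : ℕ)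
    [hp : Fact p.Prime] [CharP E p] (π : E →+* K) (hπ : Function.Surjective π)
    (hsq : ∀ e, π e = 0 → e * e = 0) : ∃ s : K →+* E, π.comp s = RingHom.id K := by
  have : CharP K p := by
    rw [CharP.charP_iff_prime_eq_zero hp.out]
    rw [← map_natCast π, CharP.cast_eq_zero, map_zero]
  let T : Set (Subring E) := {L | (∀ e, e ^ p ∈ L) ∧ ∀ l ∈ L, π l = 0 → l = 0}
  obtain ⟨L, -, hL⟩ := zorn_le_nonempty₀ T (fun c hc hchain L₀ hL₀ => by
    refine ⟨sSup c, ⟨fun e => (le_sSup hL₀ : L₀ ≤ _) ((hc hL₀).1 e), fun l hl => ?_⟩,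
      fun _ => le_sSup⟩
    obtain ⟨L, hL, hlL⟩ := (Subring.mem_sSup_of_directedOn ⟨_, hL₀⟩ hchain.directedOn).1 hl
    exact (hc hL).2 l hlL) (frobenius E p).range ⟨fun e => ⟨e, rfl⟩, by
      rintro _ ⟨e, rfl⟩ he
      rw [frobenius_def] at he ⊢
      rw [map_pow] at he
      have := hsq e (pow_eq_zero_iff hp.out.ne_zero |>.1 he)
      exact pow_eq_zero_of_le hp.out.two_le (by rwa [pow_two])⟩
  obtain ⟨hLp, hLi⟩ := hL.prop
  have hfield : IsField L := ⟨⟨0, 1, fun h => by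
      have := congrArg (fun l : L => π l) h
      simp at this⟩, mul_comm, fun {l} hl => by
    have hl' : π l ≠ 0 := fun h => hl (Subtype.ext (hLi l l.2 h))
    obtain ⟨e, he⟩ := hπ (π l)⁻¹
    refine ⟨l ^ (p - 1) * ⟨e ^ p, hLp e⟩, ?_⟩
    rw [← mul_assoc, mul_pow_sub_one hp.out.ne_zero, ← sub_eq_zero]
    refine Subtype.ext (hLi _ (Subtype.prop _) ?_)
    simp [he, hl']⟩
  let _ := hfield.toField
  let ψ : L →+* K := π.comp L.subtype
  have hsurj : Function.Surjective ψ := by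
    intro a
    by_contra! hcon
    obtain ⟨e, rfl⟩ := hπ a
    have hirr : Irreducible (X ^ p - C (⟨e ^ p, hLp e⟩ : L)) :=
      X_pow_sub_C_irreducible_of_prime hp.out fun b hb => hcon b (by
        apply frobenius_inj K p
        have := congrArg (fun l : L => π l) hb
        simpa [frobenius_def, ψ] using this)
    let ev : L[X] →+* E := eval₂RingHom L.subtype e
    have hev : ev (X ^ p - C (⟨e ^ p, hLp e⟩ : L)) = 0 := by simp [ev]
    have hmem : ev.range ∈ T := by
      refine ⟨fun x => ⟨C ⟨x ^ p, hLp x⟩, by simp [ev]⟩, ?_⟩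
      rintro _ ⟨q, rfl⟩ hq
      obtain h | h := EuclideanDomain.dvd_or_coprime _ q hirr
      · obtain ⟨v, rfl⟩ := h
        rw [map_mul, hev, zero_mul]
      · obtain ⟨u, v, huv⟩ := h
        have := congrArg (fun q => π (ev q)) huv
        simp [map_add, map_mul, hev, hq, -coe_eval₂RingHom] at this
    have hle : ev.range ≤ L := hL.le_of_ge hmem fun x hx => ⟨C ⟨x, hx⟩, by simp [ev]⟩
    exact hcon ⟨e, hle ⟨X, by simp [ev]⟩⟩ rfl
  let φ := RingEquiv.ofBijective ψ ⟨ψ.injective, hsurj⟩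
  exact ⟨L.subtype.comp φ.symm.toRingHom, RingHom.ext fun a => φ.apply_symm_apply a⟩

theorem Algebra.FormallySmooth.of_zmod (p : ℕ) [hp : Fact p.Prime] (K : Type*) [Field K]
    [Algebra (ZMod p) K] : Algebra.FormallySmooth (ZMod p) K := by
  refine .of_comp_surjective fun B _ _ I hI f => ?_
  let E : Subalgebra (ZMod p) (B × K) := AlgHom.equalizer
    ((Ideal.Quotient.mkₐ (ZMod p) I).comp (AlgHom.fst (ZMod p) B K))
    (f.comp (AlgHom.snd (ZMod p) B K))
  have hE (e : E) : Ideal.Quotient.mk I e.1.1 = f e.1.2 := e.2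
  let π : E →+* K := (RingHom.snd B K).comp (E.val : E →+* B × K)
  have : CharP E p :=
    have : Nontrivial E := π.domain_nontrivial
    charP_of_injective_algebraMap' (ZMod p) p
  obtain ⟨s, hs⟩ := exists_section_of_square_zero p π
    (fun a => by
      obtain ⟨b, hb⟩ := Ideal.Quotient.mk_surjective (f a)
      exact ⟨⟨(b, a), hb⟩, rfl⟩)
    (fun e (he : e.1.2 = 0) => by
      have h1 := hE e
      rw [he, map_zero, Ideal.Quotient.eq_zero_iff_mem] at h1
      refine Subtype.ext (Prod.ext ?_ ?_)
      · have := Ideal.mul_mem_mul h1 h1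
        rw [← pow_two, hI] at this
        exact this
      · simp [he])
  let g : K →+* B := ((RingHom.fst B K).comp (E.val : E →+* B × K)).comp s
  refine ⟨⟨g, fun r => ?_⟩, ?_⟩
  · exact RingHom.congr_fun
      (Subsingleton.elim (g.comp (algebraMap (ZMod p) K)) (algebraMap (ZMod p) B)) r
  · ext a
    exact (hE (s a)).trans (congrArg f (RingHom.congr_fun hs a))

/-- An artinian local ring containing a field has a coefficient field. -/
theorem IsLocalRing.exists_coefficient_field (A : Type) [CommRing A] [IsLocalRing A]
    [IsArtinianRing A] (hfield : ∃ (k : Type) (_ : Field k), Nonempty (k →+* A)) :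
    ∃ s : IsLocalRing.ResidueField A →+* A,
      (IsLocalRing.residue A).comp s = RingHom.id (IsLocalRing.ResidueField A) := by
  obtain ⟨k, _, ⟨i⟩⟩ := hfield
  have hnil : IsNilpotent (IsLocalRing.maximalIdeal A) := by
    rw [← IsLocalRing.jacobson_eq_maximalIdeal ⊥ bot_ne_top]
    exact IsArtinianRing.isNilpotent_jacobson_bot
  have key (F : Type) [Field F] [Algebra F A]
      [Algebra.FormallySmooth F (IsLocalRing.ResidueField A)] :
      ∃ s : IsLocalRing.ResidueField A →+* A,
        (IsLocalRing.residue A).comp s = RingHom.id (IsLocalRing.ResidueField A) := by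
    let g := Algebra.FormallySmooth.lift (IsLocalRing.maximalIdeal A) hnil
      (AlgHom.id F (IsLocalRing.ResidueField A))
    refine ⟨g, RingHom.ext fun a => ?_⟩
    exact DFunLike.congr_fun (Algebra.FormallySmooth.comp_lift (IsLocalRing.maximalIdeal A) hnil
      (AlgHom.id F (IsLocalRing.ResidueField A))) a
  obtain ⟨p, _⟩ := CharP.exists k
  obtain hp | rfl := CharP.char_is_prime_or_zero k p
  · have : Fact p.Prime := ⟨hp⟩
    let _ : Algebra (ZMod p) A := (i.comp (ZMod.castHom dvd_rfl k)).toAlgebra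
    have := Algebra.FormallySmooth.of_zmod p (IsLocalRing.ResidueField A)
    exact key (ZMod p)
  · have := CharP.charP_to_charZero k
    let _ : Algebra ℚ A := (i.comp (algebraMap ℚ k)).toAlgebra
    have : Algebra.FormallySmooth ℚ (IsLocalRing.ResidueField A) := by
      obtain ⟨s, hs⟩ := exists_isTranscendenceBasis ℚ (IsLocalRing.ResidueField A)
      have := hs.isAlgebraic_field
      exact .of_algebraicIndependent_of_isSeparable hs.1
    exact key ℚ

theorem Matrix.map_algebraMap_map {K S m n : Type*} [CommSemiring K] [Semiring S] [Algebra K S]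
    (ev : S →ₐ[K] K) (M : Matrix m n K) : (M.map (algebraMap K S)).map ev = M := by
  ext; simp

theorem AlgHom.map_det_eq_one {K S n : Type*} [CommRing K] [CommRing S] [Algebra K S]
    [Fintype n] [DecidableEq n] (ev : S →ₐ[K] K) {M : Matrix n n S} (hM : M.map ev = 1) :
    ev M.det = 1 := by
  rw [AlgHom.map_det]
  change (M.map ev).det = 1
  rw [hM, Matrix.det_one]

open Matrix in
/-- A solution of a linear system at a rational point extends to a global solution, provided the
system is the first map of a complex that is exact at that point. -/
theorem exists_mulVec_eq_zero_of_exact_at {K S : Type*} [Field K] [CommRing S] [Algebra K S]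
    (ev : S →ₐ[K] K) {l m n : Type*} [Fintype l] [Fintype m] [Fintype n]
    (f : Matrix m l S) (h : Matrix n m S) (hf : h * f = 0)
    (hex : ∀ w : m → K, h.map ev *ᵥ w = 0 → ∃ v : l → K, f.map ev *ᵥ v = w)
    (v : l → K) (hv : f.map ev *ᵥ v = 0) :
    ∃ u : l → S, f *ᵥ u = 0 ∧ ev ∘ u = v := by
  classical
  set H : (m → K) →ₗ[K] (n → K) := (h.map ev).mulVecLin with hH
  let r := Module.finrank K H.range
  let e : H.range ≃ₗ[K] (Fin r → K) := (Module.finBasis K H.range).equivFun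
  obtain ⟨P, hP⟩ := LinearMap.exists_extend (e : H.range →ₗ[K] (Fin r → K))
  have hP' : P ∘ₗ H = e.toLinearMap ∘ₗ H.rangeRestrict := by
    rw [← hP]; ext; simp
  have hsurj : (P ∘ₗ H).range = ⊤ := by
    rw [hP', LinearMap.range_eq_top]
    exact e.surjective.comp H.surjective_rangeRestrict
  have hker (w : m → K) (hw : P (H w) = 0) : H w = 0 := by
    have := LinearMap.congr_fun hP' w
    simp only [LinearMap.comp_apply, LinearEquiv.coe_coe, hw] at this
    have := (e.map_eq_zero_iff).1 this.symm
    simpa using congrArg Subtype.val this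
  obtain ⟨τ, hτ⟩ := LinearMap.exists_rightInverse_of_surjective _ hsurj
  -- matrices over `K`
  let p : Matrix (Fin r) n K := LinearMap.toMatrix' P
  let t : Matrix m (Fin r) K := LinearMap.toMatrix' τ
  have hpH : p * h.map ev = LinearMap.toMatrix' (P ∘ₗ H) := by
    rw [LinearMap.toMatrix'_comp, hH, ← Matrix.toLin'_apply', LinearMap.toMatrix'_toLin']
  have hpt : p * h.map ev * t = 1 := by
    rw [hpH, ← LinearMap.toMatrix'_comp, hτ, LinearMap.toMatrix'_id]
  have hs (j : m) : ∃ x : l → K, f.map ev *ᵥ x = (1 - t * (p * h.map ev)).col j := by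
    apply hex
    apply hker
    have : P ∘ₗ H = (p * h.map ev).mulVecLin := by
      rw [hpH, ← Matrix.toLin'_apply', Matrix.toLin'_toMatrix']
    change (P ∘ₗ H) _ = 0
    rw [this, Matrix.mulVecLin_apply, ← Matrix.mulVec_single_one, Matrix.mulVec_mulVec,
      Matrix.mul_sub, Matrix.mul_one, ← Matrix.mul_assoc _ t, hpt, Matrix.one_mul, sub_self,
      Matrix.zero_mulVec]
  choose s hs using hs
  let σ : Matrix l m K := Matrix.of fun i j => s j i
  have hσ : f.map ev * σ = 1 - t * (p * h.map ev) := by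
    ext i j
    exact congrFun (hs j) i
  -- lift to `S`
  let h' := p.map (algebraMap K S) * h
  let t' := t.map (algebraMap K S)
  let σ' := σ.map (algebraMap K S)
  let v' : l → S := algebraMap K S ∘ v
  have hf' : h' * f = 0 := by simp only [h', Matrix.mul_assoc, hf, Matrix.mul_zero]
  let θ := f * σ' + t' * h'
  let α := h' * t'
  have hαh : α * h' = h' * θ := by
    simp only [α, θ, Matrix.mul_add, ← Matrix.mul_assoc, hf', Matrix.zero_mul, zero_add]
  have hh'ev : h'.map ev = p * h.map ev := by
    rw [Matrix.map_mul, Matrix.map_algebraMap_map]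
  have hθev : θ.map ev = 1 := by
    change (f * σ' + t' * h').map ev = 1
    rw [Matrix.map_add _ (map_add ev), Matrix.map_mul, Matrix.map_mul, Matrix.map_algebraMap_map,
      Matrix.map_algebraMap_map, hh'ev, hσ]
    simp
  have hαev : α.map ev = 1 := by
    rw [Matrix.map_mul, Matrix.map_algebraMap_map, hh'ev, hpt]
  let w := θ.adjugate *ᵥ (f *ᵥ v')
  have hw : θ.det • (f *ᵥ v') = f *ᵥ (σ' *ᵥ w) + t' *ᵥ (h' *ᵥ w) := by
    have : θ *ᵥ w = θ.det • (f *ᵥ v') := by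
      simp only [w, Matrix.mulVec_mulVec, ← Matrix.mul_assoc, Matrix.mul_adjugate]
      simp [Matrix.smul_mulVec]
    rw [← this]
    simp only [θ, Matrix.add_mulVec, Matrix.mulVec_mulVec]
  have hαw : α *ᵥ (h' *ᵥ w) = 0 := by
    rw [Matrix.mulVec_mulVec, hαh, ← Matrix.mulVec_mulVec]
    simp only [w, Matrix.mulVec_mulVec, ← Matrix.mul_assoc]
    rw [Matrix.mul_assoc h' θ, Matrix.mul_adjugate]
    simp [hf']
  have hαw' : α.det • (h' *ᵥ w) = 0 := by
    have := congrArg (α.adjugate *ᵥ ·) hαw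
    simpa [Matrix.mulVec_mulVec, ← Matrix.mul_assoc, Matrix.adjugate_mul,
      Matrix.smul_mulVec] using this
  refine ⟨α.det • (θ.det • v' - σ' *ᵥ w), ?_, ?_⟩
  · rw [Matrix.mulVec_smul, Matrix.mulVec_sub, Matrix.mulVec_smul, hw, add_sub_cancel_left,
      ← Matrix.mulVec_smul, hαw', Matrix.mulVec_zero]
  · have hfv : ev ∘ (f *ᵥ v') = 0 := by
      rw [← hv]
      ext i
      simp [Matrix.mulVec, dotProduct, v']
    have hw0 : ev ∘ w = 0 := by
      ext i
      simp only [w, Matrix.mulVec, dotProduct, Function.comp_apply, map_sum, map_mul]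
      refine Finset.sum_eq_zero fun j _ => ?_
      have := congrFun hfv j
      simp only [Matrix.mulVec, dotProduct, Function.comp_apply, map_sum, map_mul] at this
      rw [this]; simp
    ext i
    have : ev ((σ' *ᵥ w) i) = 0 := by
      simp only [Matrix.mulVec, dotProduct, map_sum, map_mul]
      refine Finset.sum_eq_zero fun j _ => ?_
      have := congrFun hw0 j
      simp only [Function.comp_apply] at this
      rw [this]; simp
    simp [ev.map_det_eq_one hθev, ev.map_det_eq_one hαev, this, v']

theorem LinearMap.toMatrix'_map_algHom {K S a b : Type*} [CommRing K] [CommRing S] [Algebra K S]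
    [Fintype a] [DecidableEq a] (ev : S →ₐ[K] K)
    (g : (a → S) →ₗ[S] (b → S)) (gx : (a → K) →ₗ[K] (b → K)) (hg : ∀ u, gx (ev ∘ u) = ev ∘ g u) :
    (LinearMap.toMatrix' g).map ev = LinearMap.toMatrix' gx := by
  ext i j
  have := congrFun (hg (Pi.single j 1)) i
  have h2 : ev ∘ (Pi.single j 1 : a → S) = Pi.single j 1 := by
    ext k
    by_cases hk : k = j
    · subst hk; simp
    · simp [hk]
  rw [h2] at this
  simpa [LinearMap.toMatrix'_apply] using this.symm

/-- Coordinate-free version of `exists_mulVec_eq_zero_of_exact_at`. -/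
theorem exists_apply_eq_zero_of_exact_at {K S : Type*} [Field K] [CommRing S] [Algebra K S]
    (ev : S →ₐ[K] K) {l m n : Type*} [Finite l] [Finite m] [Finite n]
    (f : (l → S) →ₗ[S] (m → S)) (h : (m → S) →ₗ[S] (n → S)) (hf : ∀ u, h (f u) = 0)
    (fx : (l → K) →ₗ[K] (m → K)) (hx : (m → K) →ₗ[K] (n → K))
    (hfx : ∀ u, fx (ev ∘ u) = ev ∘ f u) (hhx : ∀ u, hx (ev ∘ u) = ev ∘ h u)
    (hex : ∀ w, hx w = 0 → ∃ v, fx v = w) (v : l → K) (hv : fx v = 0) :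
    ∃ u : l → S, f u = 0 ∧ ev ∘ u = v := by
  classical
  have := Fintype.ofFinite l
  have := Fintype.ofFinite m
  have := Fintype.ofFinite n
  rw [← LinearMap.toMatrix'_mulVec] at hv
  have := exists_mulVec_eq_zero_of_exact_at ev (LinearMap.toMatrix' f) (LinearMap.toMatrix' h)
    ?_ ?_ v ?_
  · simpa [LinearMap.toMatrix'_mulVec] using this
  · rw [← LinearMap.toMatrix'_comp, show h ∘ₗ f = 0 from LinearMap.ext hf, map_zero]
  · simpa only [LinearMap.toMatrix'_map_algHom ev _ _ hfx, LinearMap.toMatrix'_map_algHom ev _ _ hhx,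
      LinearMap.toMatrix'_mulVec] using hex
  · rwa [LinearMap.toMatrix'_map_algHom ev _ _ hfx]

/-- A representation all of whose derivations are inner. -/
def IsRigidRep {K A n : Type*} [Field K] [CommRing A] [Algebra K A] [Fintype n] [DecidableEq n]
    (x : A →ₐ[K] Matrix n n K) : Prop :=
  ∀ D : A →ₗ[K] Matrix n n K, (∀ a b, D (a * b) = x a * D b + D a * x b) →
    ∃ φ : Matrix n n K, ∀ a, D a = φ * x a - x a * φ

/-- The representations of a finite-dimensional algebra on `Kⁿ` are the rational points of an
affine scheme of finite type that carries a tautological representation. -/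
theorem exists_tautological_rep (K A n : Type) [Field K] [CommRing A] [Algebra K A]
    [Module.Finite K A] [Fintype n] [DecidableEq n] :
    ∃ (S : Type) (_ : CommRing S) (_ : Algebra K S) (_ : IsNoetherianRing S)
      (ρ : A →ₐ[K] Matrix n n S), ∀ y : A →ₐ[K] Matrix n n K, ∃ ev : S →ₐ[K] K,
        ∀ a, (ρ a).map ev = y a := by
  let b := Module.finBasis K A
  let coord (a : A) (i j : n) : (A →ₐ[K] Matrix n n K) → K := fun y => y a i j
  let S := Algebra.adjoin K (Set.range fun c : (Fin (Module.finrank K A)) × n × n =>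
    coord (b c.1) c.2.1 c.2.2)
  have hmem (a : A) (i j : n) : coord a i j ∈ S := by
    have : coord a i j = ∑ c, b.repr a c • coord (b c) i j := by
      ext y
      have := congrArg (fun a => y a i j) (b.sum_repr a)
      simpa only [map_sum, map_smul, Matrix.sum_apply, Finset.sum_apply, Pi.smul_apply,
        Matrix.smul_apply] using this.symm
    rw [this]
    refine Subalgebra.sum_mem _ fun c _ => Subalgebra.smul_mem _ (Algebra.subset_adjoin ?_) _
    exact ⟨(c, i, j), rfl⟩
  have hS : Algebra.FiniteType K S := by
    rw [← Subalgebra.fg_iff_finiteType]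
    exact Subalgebra.fg_def.2 ⟨_, Set.finite_range _, rfl⟩
  have : IsNoetherianRing S := Algebra.FiniteType.isNoetherianRing K S
  let ρ : A →ₐ[K] Matrix n n S := AlgHom.ofLinearMap
    { toFun a := Matrix.of fun i j => ⟨coord a i j, hmem a i j⟩
      map_add' a b := by ext i j y; simp [coord]
      map_smul' a b := by ext i j y; simp [coord] }
    (by ext i j y; by_cases h : i = j <;> simp [coord, h, Matrix.one_apply])
    (fun a b => by ext i j y; simp [coord, Matrix.mul_apply])
  refine ⟨S, inferInstance, inferInstance, this, ρ, fun y =>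
    ⟨(Pi.evalAlgHom K (fun _ => K) y).comp S.val, fun a => ?_⟩⟩
  ext i j
  simp [ρ, coord]

/-- Linear maps out of a finite-dimensional space, in coordinates. -/
noncomputable def basisConstrMatrix {K A ι n S : Type*} [Field K] [CommRing A] [Algebra K A]
    [CommRing S] [Algebra K S] (b : Module.Basis ι K A) :
    (ι × n × n → S) →ₗ[S] (A →ₗ[K] Matrix n n S) :=
  (b.constr S).toLinearMap ∘ₗ
    { toFun D c := Matrix.of fun i j => D (c, i, j)
      map_add' _ _ := rfl
      map_smul' _ _ := rfl }

theorem basisConstrMatrix_apply_basis {K A ι n S : Type*} [Field K] [CommRing A] [Algebra K A]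
    [CommRing S] [Algebra K S] (b : Module.Basis ι K A) (D : ι × n × n → S) (c : ι) :
    basisConstrMatrix b D (b c) = Matrix.of fun i j => D (c, i, j) := by
  simp [basisConstrMatrix]
  rfl

theorem basisConstrMatrix_map {K A ι n S : Type*} [Field K] [CommRing A] [Algebra K A]
    [CommRing S] [Algebra K S] (ev : S →ₐ[K] K) (b : Module.Basis ι K A) (D : ι × n × n → S)
    (a : A) : (basisConstrMatrix b D a).map ev = basisConstrMatrix b (ev ∘ D) a := by
  have : (ev.toLinearMap.mapMatrix ∘ₗ basisConstrMatrix b D : A →ₗ[K] Matrix n n K) =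
      basisConstrMatrix b (ev ∘ D) :=
    b.ext fun c => by
      ext i j
      simp [basisConstrMatrix_apply_basis]
  exact LinearMap.congr_fun this a

/-- `φ ↦ (a ↦ φ x(a) - ρ(a) φ)` in coordinates. -/
noncomputable def intertwinerMap {K A ι n S : Type*} [Field K] [CommRing A] [Algebra K A]
    [Fintype n] [DecidableEq n] [CommRing S] [Algebra K S] (b : Module.Basis ι K A)
    (x ρ : A →ₐ[K] Matrix n n S) : (n × n → S) →ₗ[S] (ι × n × n → S) where
  toFun φ c := (Matrix.of (fun i j => φ (i, j)) * x (b c.1) -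
    ρ (b c.1) * Matrix.of (fun i j => φ (i, j))) c.2.1 c.2.2
  map_add' φ ψ := by
    ext c
    simp only [Matrix.sub_apply, Matrix.mul_apply, Matrix.of_apply, Pi.add_apply, add_mul, mul_add,
      Finset.sum_add_distrib]
    ring
  map_smul' r φ := by
    ext c
    simp only [Matrix.sub_apply, Matrix.mul_apply, Matrix.of_apply, Pi.smul_apply, smul_eq_mul,
      mul_assoc, mul_left_comm _ r, ← Finset.mul_sum, RingHom.id_apply, mul_sub]

/-- `D ↦ ((a, a') ↦ D(aa') - ρ(a) D(a') - D(a) x(a'))` in coordinates. -/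
noncomputable def derivationMap {K A ι n S : Type*} [Field K] [CommRing A] [Algebra K A]
    [Fintype n] [DecidableEq n] [CommRing S] [Algebra K S] (b : Module.Basis ι K A)
    (x ρ : A →ₐ[K] Matrix n n S) : (ι × n × n → S) →ₗ[S] (ι × ι × n × n → S) where
  toFun D c := (basisConstrMatrix b D (b c.1 * b c.2.1) - ρ (b c.1) * basisConstrMatrix b D (b c.2.1)
    - basisConstrMatrix b D (b c.1) * x (b c.2.1)) c.2.2.1 c.2.2.2
  map_add' φ ψ := by
    ext c
    simp only [map_add, LinearMap.add_apply, mul_add, add_mul, Matrix.sub_apply, Matrix.add_apply,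
      Pi.add_apply]
    ring
  map_smul' r φ := by
    ext c
    simp only [map_smul, LinearMap.smul_apply, Matrix.mul_smul, Matrix.smul_mul, Matrix.sub_apply,
      Matrix.smul_apply, Pi.smul_apply, smul_sub, RingHom.id_apply]

theorem intertwinerMap_map {K A ι n S : Type*} [Field K] [CommRing A] [Algebra K A]
    [Fintype n] [DecidableEq n] [CommRing S] [Algebra K S] (b : Module.Basis ι K A)
    (x ρ : A →ₐ[K] Matrix n n S) (ev : S →ₐ[K] K) (x' ρ' : A →ₐ[K] Matrix n n K)
    (hx : ∀ a, (x a).map ev = x' a) (hρ : ∀ a, (ρ a).map ev = ρ' a) (u : n × n → S) :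
    intertwinerMap b x' ρ' (ev ∘ u) = ev ∘ intertwinerMap b x ρ u := by
  ext c
  simp [intertwinerMap, Matrix.mul_apply, ← hx, ← hρ]

theorem derivationMap_map {K A ι n S : Type*} [Field K] [CommRing A] [Algebra K A]
    [Fintype n] [DecidableEq n] [CommRing S] [Algebra K S] (b : Module.Basis ι K A)
    (x ρ : A →ₐ[K] Matrix n n S) (ev : S →ₐ[K] K) (x' ρ' : A →ₐ[K] Matrix n n K)
    (hx : ∀ a, (x a).map ev = x' a) (hρ : ∀ a, (ρ a).map ev = ρ' a) (u : ι × n × n → S) :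
    derivationMap b x' ρ' (ev ∘ u) = ev ∘ derivationMap b x ρ u := by
  ext c
  simp [derivationMap, Matrix.mul_apply, ← hx, ← hρ, ← basisConstrMatrix_map]

theorem basisConstrMatrix_intertwinerMap {K A ι n S : Type*} [Field K] [CommRing A] [Algebra K A]
    [Fintype n] [DecidableEq n] [CommRing S] [Algebra K S] (b : Module.Basis ι K A)
    (x ρ : A →ₐ[K] Matrix n n S) (φ : n × n → S) (a : A) :
    basisConstrMatrix b (intertwinerMap b x ρ φ) a =
      Matrix.of (fun i j => φ (i, j)) * x a - ρ a * Matrix.of (fun i j => φ (i, j)) := by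
  have : basisConstrMatrix b (intertwinerMap b x ρ φ) =
      LinearMap.mulLeft K (Matrix.of (fun i j => φ (i, j))) ∘ₗ x.toLinearMap -
      LinearMap.mulRight K (Matrix.of (fun i j => φ (i, j))) ∘ₗ ρ.toLinearMap :=
    b.ext fun c => by
      rw [basisConstrMatrix_apply_basis]; rfl
  rw [this]; rfl

theorem derivationMap_intertwinerMap {K A ι n S : Type*} [Field K] [CommRing A] [Algebra K A]
    [Fintype n] [DecidableEq n] [CommRing S] [Algebra K S] (b : Module.Basis ι K A)
    (x ρ : A →ₐ[K] Matrix n n S) (φ : n × n → S) :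
    derivationMap b x ρ (intertwinerMap b x ρ φ) = 0 := by
  ext c
  simp only [derivationMap, LinearMap.coe_mk, AddHom.coe_mk, basisConstrMatrix_intertwinerMap,
    map_mul]
  generalize Matrix.of (fun i j => φ (i, j)) = P
  have (X Y X' Y' : Matrix n n S) :
      P * (X * X') - Y * Y' * P - Y * (P * X' - Y' * P) - (P * X - Y * P) * X' = 0 := by
    noncomm_ring
  rw [this]; rfl

/-- The isomorphism class of a rigid representation is Zariski open. -/
theorem IsRigidRep.exists_isomorphic_near {K A n S : Type*} [Field K] [CommRing A] [Algebra K A]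
    [Module.Finite K A] [Fintype n] [DecidableEq n] [CommRing S] [Algebra K S]
    (ρ : A →ₐ[K] Matrix n n S) (ev : S →ₐ[K] K) (x : A →ₐ[K] Matrix n n K)
    (hev : ∀ a, (ρ a).map ev = x a) (hx : IsRigidRep x) :
    ∃ g : S, ev g = 1 ∧ ∀ (ev' : S →ₐ[K] K) (y : A →ₐ[K] Matrix n n K),
      (∀ a, (ρ a).map ev' = y a) → ev' g ≠ 0 →
      ∃ P : Matrix n n K, IsUnit P.det ∧ ∀ a, P * x a = y a * P := by
  let b := Module.finBasis K A
  let x' : A →ₐ[K] Matrix n n S := ((Algebra.ofId K S).mapMatrix).comp x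
  have hx' (e : S →ₐ[K] K) (a : A) : (x' a).map e = x a := Matrix.map_algebraMap_map e (x a)
  have hex (D : _ → K) (hD : derivationMap b x x D = 0) : ∃ φ, intertwinerMap b x x φ = D := by
    have hder (a a' : A) : basisConstrMatrix b D (a * a') =
        x a * basisConstrMatrix b D a' + basisConstrMatrix b D a * x a' := by
      let D' := basisConstrMatrix b D
      have : D' ∘ₗ LinearMap.mul' K A =
        (LinearMap.mul' K (Matrix n n K)) ∘ₗ TensorProduct.map x.toLinearMap D' +
        (LinearMap.mul' K (Matrix n n K)) ∘ₗ TensorProduct.map D' x.toLinearMap := by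
        refine (b.tensorProduct b).ext fun c => ?_
        rw [Module.Basis.tensorProduct_apply']
        ext i j
        have := congrFun hD (c.1, c.2, i, j)
        simp only [derivationMap, LinearMap.coe_mk, AddHom.coe_mk, Matrix.sub_apply,
          Pi.zero_apply, sub_eq_iff_eq_add] at this
        simpa [D', add_comm] using this
      simpa [D'] using LinearMap.congr_fun this (a ⊗ₜ a')
    obtain ⟨φ, hφ⟩ := hx _ hder
    refine ⟨fun c => φ c.1 c.2, ?_⟩
    ext ⟨c, i, j⟩
    have := congrFun (congrFun (hφ (b c)) i) j
    rw [basisConstrMatrix_apply_basis] at this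
    exact this.symm
  obtain ⟨u, hu, hu1⟩ := exists_apply_eq_zero_of_exact_at ev (intertwinerMap b x' ρ)
    (derivationMap b x' ρ) (derivationMap_intertwinerMap b x' ρ) (intertwinerMap b x x)
    (derivationMap b x x) (intertwinerMap_map b x' ρ ev x x (hx' ev) hev)
    (derivationMap_map b x' ρ ev x x (hx' ev) hev) hex
    (fun c => (1 : Matrix n n K) c.1 c.2) (by
      ext c
      have h1 : (Matrix.of fun i j => (1 : Matrix n n K) i j) = 1 := rfl
      simp only [intertwinerMap, LinearMap.coe_mk, AddHom.coe_mk]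
      rw [h1, Matrix.one_mul, Matrix.mul_one, sub_self]
      rfl)
  let Φ : Matrix n n S := Matrix.of fun i j => u (i, j)
  have hΦ (a : A) : Φ * x' a = ρ a * Φ := by
    have := basisConstrMatrix_intertwinerMap b x' ρ u a
    rw [hu, map_zero, LinearMap.zero_apply] at this
    exact (sub_eq_zero.1 this.symm)
  refine ⟨Φ.det, ev.map_det_eq_one ?_, fun ev' y hy hne => ⟨Φ.map ev', ?_, fun a => ?_⟩⟩
  · ext i j
    exact congrFun hu1 (i, j)
  · rw [AlgHom.map_det] at hne
    exact hne.isUnit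
  · rw [← hy, ← hx' ev' a, ← Matrix.map_mul, ← Matrix.map_mul, hΦ]

/-- A finite-dimensional algebra has finitely many rigid representations of given dimension. -/
theorem finite_rigid_reps (K A n : Type) [Field K] [CommRing A] [Algebra K A]
    [Module.Finite K A] [Fintype n] [DecidableEq n] :
    ∃ t : Set (A →ₐ[K] Matrix n n K), t.Finite ∧ ∀ y, IsRigidRep y → ∃ x ∈ t,
      ∃ P : Matrix n n K, IsUnit P.det ∧ ∀ a, P * x a = y a * P := by
  obtain ⟨S, _, _, _, ρ, hρ⟩ := exists_tautological_rep K A n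
  choose ev hev using hρ
  have key (x : {x : A →ₐ[K] Matrix n n K // IsRigidRep x}) :=
    x.2.exists_isomorphic_near ρ (ev x) x (hev x)
  choose g hg1 hg using key
  obtain ⟨s, hs, hspan⟩ := (Submodule.fg_span_iff_fg_span_finset_subset (Set.range g)).1
    (IsNoetherian.noetherian (R := S) (Ideal.span (Set.range g)))
  choose pre hpre using fun c : s => hs c.2
  refine ⟨Set.range fun c => (pre c : A →ₐ[K] Matrix n n K), Set.finite_range _, fun y hy => ?_⟩
  by_contra! hcon
  have hle : Ideal.span (s : Set S) ≤ RingHom.ker (ev y) := Ideal.span_le.2 fun c hc => by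
    by_contra hne
    rw [SetLike.mem_coe, RingHom.mem_ker] at hne
    obtain ⟨P, hP, hPx⟩ := hg (pre ⟨c, hc⟩) _ y (hev y) (by rwa [hpre])
    obtain ⟨a, ha⟩ := hcon _ ⟨⟨c, hc⟩, rfl⟩ P hP
    exact ha (hPx a)
  have hmem : g ⟨y, hy⟩ ∈ Ideal.span (s : Set S) := by
    rw [← Ideal.submodule_span_eq, ← hspan]
    exact Submodule.subset_span ⟨_, rfl⟩
  have := hle hmem
  rw [RingHom.mem_ker] at this
  exact one_ne_zero ((hg1 ⟨y, hy⟩).symm.trans this)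

/-- Vanishing of derived functor `Ext` implies vanishing of `Ext` in the derived category. -/
theorem subsingleton_abelianExt_of_subsingleton (R : Type) [CommRing R] (M N : ModuleCat.{0} R)
    (n : ℕ) (h : Subsingleton (((Ext R (ModuleCat R) n).obj (Opposite.op M)).obj N)) :
    Subsingleton (Abelian.Ext M N n) := by
  let P := ProjectiveResolution.of M
  have hz : (P.complex.linearYonedaObj R N).ExactAt n := by
    rw [HomologicalComplex.exactAt_iff_isZero_homology]
    exact (ModuleCat.isZero_of_subsingleton _).of_iso (P.isoExt n N).symm
  suffices H : ∀ x : Abelian.Ext M N n, x = 0 from ⟨fun x y => (H x).trans (H y).symm⟩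
  intro x
  obtain ⟨f, hf, rfl⟩ := P.extMk_surjective x (n + 1) rfl
  cases n with
  | zero =>
    rw [HomologicalComplex.exactAt_iff' _ 0 0 1 (by simp) (by simp),
      ShortComplex.moduleCat_exact_iff] at hz
    obtain ⟨g, hg⟩ := hz f hf
    have : f = 0 := by
      rw [← hg]
      change ((P.complex.linearYonedaObj R N).d 0 0) g = 0
      rw [HomologicalComplex.shape _ _ _ (by simp)]
      rfl
    subst this
    exact P.extMk_zero _ rfl
  | succ n =>
    rw [HomologicalComplex.exactAt_iff' _ n (n + 1) (n + 2) (by simp) (by simp),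
      ShortComplex.moduleCat_exact_iff] at hz
    obtain ⟨g, hg⟩ := hz f hf
    exact (P.extMk_eq_zero_iff _ _ rfl _ n rfl).2 ⟨g, hg⟩

/-- Vanishing of `Ext^i_R(M, N)`. -/
def ExtVanish (R M N : Type) [CommRing R] [AddCommGroup M] [Module R M] [AddCommGroup N]
    [Module R N] (i : ℕ) : Prop :=
  Subsingleton (Abelian.Ext (ModuleCat.of R M) (ModuleCat.of R N) i)

section ExtVanish

open CategoryTheory.Abelian

variable {R M M' N N' K F : Type} [CommRing R] [AddCommGroup M] [Module R M]
  [AddCommGroup M'] [Module R M'] [AddCommGroup N] [Module R N] [AddCommGroup N'] [Module R N']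
  [AddCommGroup K] [Module R K] [AddCommGroup F] [Module R F]

theorem ExtVanish.congr {i : ℕ} (h : ExtVanish R M N i) (e : M ≃ₗ[R] M') (e' : N ≃ₗ[R] N') :
    ExtVanish R M' N' i := by
  let a := e.toModuleIso
  let b := e'.toModuleIso
  have key (x : Ext (ModuleCat.of R M') (ModuleCat.of R N') i) : x = 0 := by
    have h0 : ((Ext.mk₀ a.hom).comp x (zero_add i)).comp (Ext.mk₀ b.inv) (add_zero i) = 0 :=
      h.elim _ _
    have h1 := congrArg (fun y => ((Ext.mk₀ a.inv).comp y (zero_add i)).comp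
      (Ext.mk₀ b.hom) (add_zero i)) h0
    simpa [Ext.comp_assoc_of_third_deg_zero] using h1
  exact ⟨fun x y => (key x).trans (key y).symm⟩

theorem extVanish_of_projective [Module.Projective R M] (i : ℕ) : ExtVanish R M N (i + 1) :=
  have : Projective (ModuleCat.of R M) := ModuleCat.projective_of_categoryTheory_projective _
  Ext.subsingleton_of_projective _ _ _

/-- The short exact sequence of modules attached to linear maps. -/
theorem shortExact_of_linearMap {f : K →ₗ[R] F} {g : F →ₗ[R] M} (hf : Function.Injective f)
    (hg : Function.Surjective g) (hfg : Function.Exact f g) :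
    (ModuleCat.shortComplexOfCompEqZero f g hfg.linearMap_comp_eq_zero).ShortExact :=
  ModuleCat.shortComplex_shortExact _ hfg hf hg

theorem ExtVanish.exists_extend (h : ExtVanish R M N 1) {f : K →ₗ[R] F} {g : F →ₗ[R] M}
    (hf : Function.Injective f) (hg : Function.Surjective g) (hfg : Function.Exact f g)
    (φ : K →ₗ[R] N) : ∃ ψ : F →ₗ[R] N, ψ ∘ₗ f = φ := by
  obtain ⟨x, hx⟩ := Ext.contravariant_sequence_exact₁ (shortExact_of_linearMap hf hg hfg)
    (ModuleCat.of R N) (Ext.mk₀ (ModuleCat.ofHom φ)) (add_zero 1) (h.elim _ _)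
  obtain ⟨y, rfl⟩ := (Ext.mk₀_bijective _ _).2 x
  rw [Ext.mk₀_comp_mk₀] at hx
  exact ⟨y.hom, congrArg ModuleCat.Hom.hom ((Ext.mk₀_bijective _ _).1 hx)⟩

theorem ExtVanish.exists_lift (h : ExtVanish R M N' 1) {f : N' →ₗ[R] N} {g : N →ₗ[R] K}
    (hf : Function.Injective f) (hg : Function.Surjective g) (hfg : Function.Exact f g)
    (φ : M →ₗ[R] K) : ∃ ψ : M →ₗ[R] N, g ∘ₗ ψ = φ := by
  obtain ⟨x, hx⟩ := Ext.covariant_sequence_exact₃ (ModuleCat.of R M)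
    (shortExact_of_linearMap hf hg hfg) (Ext.mk₀ (ModuleCat.ofHom φ)) (zero_add 1) (h.elim _ _)
  obtain ⟨y, rfl⟩ := (Ext.mk₀_bijective _ _).2 x
  rw [Ext.mk₀_comp_mk₀] at hx
  exact ⟨y.hom, congrArg ModuleCat.Hom.hom ((Ext.mk₀_bijective _ _).1 hx)⟩

theorem ExtVanish.of_shortExact {i : ℕ} (h : ExtVanish R M N i) (h' : ExtVanish R M N' (i + 1))
    {f : N' →ₗ[R] N} {g : N →ₗ[R] K}
    (hf : Function.Injective f) (hg : Function.Surjective g) (hfg : Function.Exact f g) :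
    ExtVanish R M K i := by
  have key (x : Ext (ModuleCat.of R M) (ModuleCat.of R K) i) : x = 0 := by
    obtain ⟨y, hy⟩ := Ext.covariant_sequence_exact₃ (ModuleCat.of R M)
      (shortExact_of_linearMap hf hg hfg) x rfl (h'.elim _ _)
    rw [← hy, show y = 0 from h.elim _ _, Ext.zero_comp]
  exact ⟨fun x y => (key x).trans (key y).symm⟩

theorem extVanish_one_of_forall_exists_extend [Module.Projective R F] {f : K →ₗ[R] F}
    {g : F →ₗ[R] M} (hf : Function.Injective f) (hg : Function.Surjective g)
    (hfg : Function.Exact f g) (h : ∀ φ : K →ₗ[R] N, ∃ ψ : F →ₗ[R] N, ψ ∘ₗ f = φ) :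
    ExtVanish R M N 1 := by
  have hS := shortExact_of_linearMap hf hg hfg
  have key (x : Ext (ModuleCat.of R M) (ModuleCat.of R N) 1) : x = 0 := by
    obtain ⟨y, rfl⟩ := Ext.contravariant_sequence_exact₃ hS
      (ModuleCat.of R N) x ((extVanish_of_projective (R := R) (M := F) (N := N) 0).elim _ _) (add_zero 1)
    obtain ⟨φ, rfl⟩ := (Ext.mk₀_bijective _ _).2 y
    obtain ⟨ψ, hψ⟩ := h φ.hom
    have : φ = ModuleCat.ofHom f ≫ ModuleCat.ofHom ψ := ModuleCat.hom_ext hψ.symm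
    rw [this, ← Ext.mk₀_comp_mk₀]
    exact hS.extClass_comp_assoc _
  exact ⟨fun x y => (key x).trans (key y).symm⟩

theorem extVanish_succ_succ_iff [Module.Projective R F] {f : K →ₗ[R] F}
    {g : F →ₗ[R] M} (hf : Function.Injective f) (hg : Function.Surjective g)
    (hfg : Function.Exact f g) (i : ℕ) :
    ExtVanish R M N (i + 2) ↔ ExtVanish R K N (i + 1) := by
  have hS := shortExact_of_linearMap hf hg hfg
  have hF (j : ℕ) := extVanish_of_projective (R := R) (M := F) (N := N) j
  refine ⟨fun h => ?_, fun h => ?_⟩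
  · have key (x : Ext (ModuleCat.of R K) (ModuleCat.of R N) (i + 1)) : x = 0 := by
      obtain ⟨y, rfl⟩ := Ext.contravariant_sequence_exact₁ hS (ModuleCat.of R N) x
        (show 1 + (i + 1) = i + 2 by lia) (h.elim _ _)
      rw [show y = 0 from (hF i).elim _ _, Ext.comp_zero]
    exact ⟨fun x y => (key x).trans (key y).symm⟩
  · have key (x : Ext (ModuleCat.of R M) (ModuleCat.of R N) (i + 2)) : x = 0 := by
      obtain ⟨y, rfl⟩ := Ext.contravariant_sequence_exact₃ hS (ModuleCat.of R N) x
        ((hF (i + 1)).elim _ _) (show 1 + (i + 1) = i + 2 by lia)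
      rw [show y = 0 from h.elim _ _, Ext.comp_zero]
    exact ⟨fun x y => (key x).trans (key y).symm⟩

end ExtVanish

section ChangeOfRings

variable {R S : Type} [CommRing R] [CommRing S] [Algebra R S]

/-- Vanishing of `Ext` against a module killed by a regular element descends to the quotient. -/
theorem ExtVanish.descend {x : R} (hx : IsSMulRegular R x)
    (hS : Function.Surjective (algebraMap R S))
    (hSx : ∀ r, algebraMap R S r = 0 ↔ ∃ s, x * s = r) (n : ℕ) {N C C' : Type}
    [AddCommGroup N] [Module R N] [Module S N] [IsScalarTower R S N]
    [AddCommGroup C] [Module R C]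
    [AddCommGroup C'] [Module R C'] [Module S C'] [IsScalarTower R S C']
    (π : C →ₗ[R] C') (hπ : Function.Surjective π) (hπx : ∀ c, π c = 0 ↔ ∃ c', x • c' = c)
    (hxC : IsSMulRegular C x) (h : ExtVanish R C N (n + 1)) : ExtVanish S C' N (n + 1) := by
  let g : (C →₀ R) →ₗ[R] C := Finsupp.linearCombination R id
  have hg : Function.Surjective g := Finsupp.linearCombination_id_surjective R C
  let g' : (C →₀ S) →ₗ[S] C' := Finsupp.linearCombination S π
  have hg' : Function.Surjective g' := fun c => by
    obtain ⟨c, rfl⟩ := hπ c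
    exact ⟨Finsupp.single c 1, by simp [g']⟩
  let ρ : (C →₀ R) →ₗ[R] (C →₀ S) := Finsupp.mapRange.linearMap (Algebra.linearMap R S)
  have hρ : Function.Surjective ρ := Finsupp.mapRange_surjective _ (map_zero _) hS
  have hx0 : algebraMap R S x = 0 := (hSx x).2 ⟨1, mul_one x⟩
  have hkill {M : Type} [AddCommGroup M] [Module R M] [Module S M] [IsScalarTower R S M] (m : M) :
      x • m = 0 := by rw [← algebraMap_smul S x m, hx0, zero_smul]
  have hρx (f : C →₀ R) : ρ f = 0 ↔ ∃ f', x • f' = f := by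
    refine ⟨fun hf => ?_, ?_⟩
    · have (c : C) : ∃ s, x * s = f c := (hSx _).1 (DFunLike.congr_fun hf c)
      choose s hs using this
      classical
      refine ⟨Finsupp.onFinset f.support (fun c => if f c = 0 then 0 else s c)
        (by simp +contextual), ?_⟩
      ext c
      by_cases hc : f c = 0 <;> simp [hc, hs]
    · rintro ⟨f', rfl⟩
      rw [map_smul, hkill]
  have hcomm (f : C →₀ R) : g' (ρ f) = π (g f) := by
    have : (g'.restrictScalars R) ∘ₗ ρ = π ∘ₗ g := by
      ext c
      simp [g', g, ρ]
    exact LinearMap.congr_fun this f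
  let ρK : LinearMap.ker g →ₗ[R] LinearMap.ker g' :=
    (ρ ∘ₗ (LinearMap.ker g).subtype).codRestrict ((LinearMap.ker g').restrictScalars R)
      (fun k => by
        change g' (ρ k) = 0
        rw [hcomm, k.2, map_zero])
  have hρK : Function.Surjective ρK := by
    rintro ⟨f', hf'⟩
    obtain ⟨f, rfl⟩ := hρ f'
    rw [LinearMap.mem_ker, hcomm, hπx] at hf'
    obtain ⟨c, hc⟩ := hf'
    obtain ⟨d, rfl⟩ := hg c
    refine ⟨⟨f - x • d, by rw [LinearMap.mem_ker, map_sub, map_smul, hc, sub_self]⟩, ?_⟩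
    refine Subtype.ext ?_
    change ρ (f - x • d) = ρ f
    rw [map_sub, map_smul, hkill, sub_zero]
  have hF : IsSMulRegular (C →₀ R) x := fun a b hab => Finsupp.ext fun c =>
    hx (DFunLike.congr_fun hab c)
  have hKx : IsSMulRegular (LinearMap.ker g) x := fun a b hab =>
    Subtype.ext (hF (congrArg Subtype.val hab))
  have hρKx (k : LinearMap.ker g) : ρK k = 0 ↔ ∃ k', x • k' = k := by
    refine ⟨fun hk => ?_, ?_⟩
    · obtain ⟨f, hf⟩ := (hρx k).1 (congrArg Subtype.val hk)
      have : g f = 0 := by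
        apply hxC
        change x • g f = x • 0
        rw [← map_smul, hf, smul_zero]
        exact k.2
      exact ⟨⟨f, this⟩, Subtype.ext hf⟩
    · rintro ⟨k', rfl⟩
      exact (map_smul ρK x k').trans (Subtype.ext (hkill _))
  have hex : Function.Exact (LinearMap.ker g).subtype g := LinearMap.exact_subtype_ker_map g
  have hex' : Function.Exact (LinearMap.ker g').subtype g' := LinearMap.exact_subtype_ker_map g'
  cases n with
  | zero =>
    refine extVanish_one_of_forall_exists_extend (Submodule.injective_subtype _) hg' hex' fun φ => ?_
    obtain ⟨ψ, hψ⟩ := h.exists_extend (Submodule.injective_subtype _) hg hex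
      (φ.restrictScalars R ∘ₗ ρK)
    let ψ' : (C →₀ S) →ₗ[S] N := Finsupp.linearCombination S fun c => ψ (Finsupp.single c 1)
    have hψ' : (ψ'.restrictScalars R) ∘ₗ ρ = ψ := by
      ext c
      simp [ψ', ρ]
    refine ⟨ψ', LinearMap.ext fun k => ?_⟩
    obtain ⟨k, rfl⟩ := hρK k
    exact (LinearMap.congr_fun hψ' k).trans (LinearMap.congr_fun hψ k)
  | succ n =>
    rw [extVanish_succ_succ_iff (Submodule.injective_subtype _) hg' hex']
    rw [extVanish_succ_succ_iff (Submodule.injective_subtype _) hg hex] at h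
    exact ExtVanish.descend hx hS hSx n ρK hρK hρKx hKx h

end ChangeOfRings

/-- Semidualizing modules, phrased with `Ext` of the abelian category of modules. -/
structure IsSemidualizingModule (R C : Type) [CommRing R] [AddCommGroup C] [Module R C] :
    Prop where
  finite : Module.Finite R C
  bijective : Function.Bijective (LinearMap.lsmul R C)
  extVanish : ∀ i, ExtVanish R C C (i + 1)

section Regular

open scoped Pointwise

variable {R M N C D : Type} [CommRing R] [AddCommGroup M] [Module R M] [AddCommGroup N]
  [Module R N] [AddCommGroup C] [Module R C] [AddCommGroup D] [Module R D] {x : R}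

theorem IsSMulRegular.exists_smul_eq (hx : IsSMulRegular N x) (f : M →ₗ[R] N)
    (h : ∀ m, ∃ n, x • n = f m) : ∃ g : M →ₗ[R] N, x • g = f := by
  choose g hg using h
  refine ⟨⟨⟨g, fun a b => hx ?_⟩, fun r a => hx ?_⟩, LinearMap.ext hg⟩
  · simp [hg]
  · simp [hg, smul_comm x r]

theorem QuotSMulTop.mkQ_eq_zero_iff {c : C} :
    Submodule.mkQ (x • (⊤ : Submodule R C)) c = 0 ↔ ∃ c', x • c' = c := by
  rw [← LinearMap.mem_ker, Submodule.ker_mkQ, Submodule.mem_smul_pointwise_iff_exists]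
  simp

theorem QuotSMulTop.exact_lsmul_mkQ :
    Function.Exact (LinearMap.lsmul R C x) (Submodule.mkQ (x • (⊤ : Submodule R C))) :=
  fun _ => QuotSMulTop.mkQ_eq_zero_iff

theorem IsSemidualizingModule.isSMulRegular [IsNoetherianRing R] (hC : IsSemidualizingModule R C)
    (hx : IsSMulRegular R x) : IsSMulRegular C x := by
  have := hC.finite
  let T := LinearMap.ker (LinearMap.lsmul R C x)
  have hT : Subsingleton (C →ₗ[R] T) := by
    refine subsingleton_of_forall_eq 0 fun ψ => ?_
    obtain ⟨r, hr⟩ := hC.bijective.2 (T.subtype ∘ₗ ψ)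
    have hr0 : r = 0 := by
      apply hx
      change x • r = x • 0
      apply hC.bijective.1
      ext c
      have h1 : r • c = ψ c := LinearMap.congr_fun hr c
      have h2 : x • (ψ c : C) = 0 := (ψ c).2
      simp [mul_smul, h1, h2]
    subst hr0
    ext c
    simpa using (LinearMap.congr_fun hr c).symm
  obtain ⟨r, hr, hrT⟩ := IsSMulRegular.subsingleton_linearMap_iff.1 hT
  have hr0 : r = 0 := by
    apply hC.bijective.1
    ext c
    simpa using Module.mem_annihilator.1 hr c
  subst hr0
  intro a b hab
  have hmem : a - b ∈ T := by
    change x • (a - b) = 0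
    rw [smul_sub, sub_eq_zero]
    exact hab
  have : (⟨a - b, hmem⟩ : T) = 0 := hrT (by simp)
  exact sub_eq_zero.1 (congrArg Subtype.val this)

theorem ExtVanish.quotSMulTop {i : ℕ} (hx : IsSMulRegular N x) (h : ExtVanish R M N i)
    (h' : ExtVanish R M N (i + 1)) : ExtVanish R M (QuotSMulTop x N) i :=
  h.of_shortExact h' (f := LinearMap.lsmul R N x) hx (Submodule.mkQ_surjective _)
    QuotSMulTop.exact_lsmul_mkQ

theorem ExtVanish.exists_lift_quotSMulTop (h : ExtVanish R M N 1) (hx : IsSMulRegular N x)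
    (φ : M →ₗ[R] QuotSMulTop x N) :
    ∃ ψ : M →ₗ[R] N, Submodule.mkQ (x • (⊤ : Submodule R N)) ∘ₗ ψ = φ :=
  h.exists_lift (f := LinearMap.lsmul R N x) hx (Submodule.mkQ_surjective _)
    QuotSMulTop.exact_lsmul_mkQ φ

theorem ExtVanish.of_quotSMulTop [IsNoetherianRing R] [IsLocalRing R] [Module.Finite R M]
    [Module.Finite R N] (hxm : x ∈ IsLocalRing.maximalIdeal R) (hx : IsSMulRegular N x)
    (h : ExtVanish R M (QuotSMulTop x N) 1) : ExtVanish R M N 1 := by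
  obtain ⟨n, g, hg⟩ := Module.Finite.exists_fin' R M
  have hK := Submodule.injective_subtype (LinearMap.ker g)
  have hex := LinearMap.exact_subtype_ker_map g
  refine extVanish_one_of_forall_exists_extend hK hg hex ?_
  let res : ((Fin n → R) →ₗ[R] N) →ₗ[R] (LinearMap.ker g →ₗ[R] N) :=
    LinearMap.lcomp R N (LinearMap.ker g).subtype
  suffices H : (⊤ : Submodule R (LinearMap.ker g →ₗ[R] N)) ≤ LinearMap.range res from
    fun φ => H (Submodule.mem_top (x := φ))
  refine Submodule.le_of_le_smul_of_le_jacobson_bot (I := IsLocalRing.maximalIdeal R)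
    (IsNoetherian.noetherian _) (IsLocalRing.maximalIdeal_le_jacobson _) fun φ _ => ?_
  obtain ⟨ψ', hψ'⟩ := h.exists_extend hK hg hex (Submodule.mkQ _ ∘ₗ φ)
  obtain ⟨ψ, rfl⟩ := Module.projective_lifting_property _ ψ'
    (Submodule.mkQ_surjective (x • (⊤ : Submodule R N)))
  obtain ⟨φ', hφ'⟩ := hx.exists_smul_eq (φ - res ψ) fun k => by
    rw [← QuotSMulTop.mkQ_eq_zero_iff, LinearMap.sub_apply, map_sub, sub_eq_zero]
    exact (LinearMap.congr_fun hψ' k).symm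
  rw [← sub_add_cancel φ (res ψ), ← hφ', add_comm]
  exact Submodule.add_mem_sup ⟨ψ, rfl⟩ (Submodule.smul_mem_smul hxm Submodule.mem_top)

theorem surjective_of_mkQ_smul_top_comp_surjective [IsLocalRing R] [Module.Finite R D]
    (hxm : x ∈ IsLocalRing.maximalIdeal R) (f : C →ₗ[R] D)
    (hf : Function.Surjective (Submodule.mkQ (x • (⊤ : Submodule R D)) ∘ₗ f)) :
    Function.Surjective f := by
  rw [← LinearMap.range_eq_top, ← top_le_iff]
  refine Submodule.le_of_le_smul_of_le_jacobson_bot (I := IsLocalRing.maximalIdeal R)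
    Module.Finite.fg_top (IsLocalRing.maximalIdeal_le_jacobson _) fun d _ => ?_
  obtain ⟨c, hc⟩ := hf (Submodule.mkQ _ d)
  obtain ⟨d', hd'⟩ := (QuotSMulTop.mkQ_eq_zero_iff (x := x) (c := d - f c)).1 (by
    rw [map_sub, sub_eq_zero]
    exact hc.symm)
  rw [← sub_add_cancel d (f c), ← hd', add_comm]
  exact Submodule.add_mem_sup ⟨c, rfl⟩ (Submodule.smul_mem_smul hxm Submodule.mem_top)

theorem IsSemidualizingModule.exists_surjective [IsNoetherianRing R] [IsLocalRing R]
    (hC : IsSemidualizingModule R C) (hD : IsSemidualizingModule R D)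
    (hxm : x ∈ IsLocalRing.maximalIdeal R) (hx : IsSMulRegular R x)
    (e : QuotSMulTop x C ≃ₗ[R] QuotSMulTop x D) :
    ∃ f : C →ₗ[R] D, Function.Surjective f := by
  have := hC.finite
  have := hD.finite
  have h1 : ExtVanish R C (QuotSMulTop x D) 1 :=
    ((hC.extVanish 0).quotSMulTop (hC.isSMulRegular hx) (hC.extVanish 1)).congr
      (LinearEquiv.refl R C) e
  obtain ⟨f, hf⟩ := (h1.of_quotSMulTop hxm (hD.isSMulRegular hx)).exists_lift_quotSMulTop
    (hD.isSMulRegular hx) (e.toLinearMap ∘ₗ Submodule.mkQ _)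
  refine ⟨f, surjective_of_mkQ_smul_top_comp_surjective hxm f ?_⟩
  rw [hf]
  exact e.surjective.comp (Submodule.mkQ_surjective _)

theorem IsSemidualizingModule.nonempty_linearEquiv [IsNoetherianRing R] [IsLocalRing R]
    (hC : IsSemidualizingModule R C) (hD : IsSemidualizingModule R D)
    (hxm : x ∈ IsLocalRing.maximalIdeal R) (hx : IsSMulRegular R x)
    (e : QuotSMulTop x C ≃ₗ[R] QuotSMulTop x D) : Nonempty (C ≃ₗ[R] D) := by
  have := hC.finite
  obtain ⟨f, hf⟩ := hC.exists_surjective hD hxm hx e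
  obtain ⟨g, hg⟩ := hD.exists_surjective hC hxm hx e.symm
  have := OrzechProperty.injective_of_surjective_endomorphism (g ∘ₗ f) (hg.comp hf)
  exact ⟨LinearEquiv.ofBijective f ⟨Function.Injective.of_comp this, hf⟩⟩

theorem IsSemidualizingModule.quotSMulTop [IsNoetherianRing R] (hC : IsSemidualizingModule R C)
    (hx : IsSMulRegular R x) :
    IsSemidualizingModule (R ⧸ Ideal.span {x}) (QuotSMulTop x C) := by
  have := hC.finite
  have hxC := hC.isSMulRegular hx
  have hS : Function.Surjective (algebraMap R (R ⧸ Ideal.span {x})) := Ideal.Quotient.mk_surjective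
  have hSx (r : R) : algebraMap R (R ⧸ Ideal.span {x}) r = 0 ↔ ∃ s, x * s = r := by
    rw [Ideal.Quotient.algebraMap_eq, Ideal.Quotient.eq_zero_iff_dvd]
    exact exists_congr fun _ => eq_comm
  refine ⟨Module.Finite.of_restrictScalars_finite R _ _, ⟨?_, ?_⟩, fun i => ?_⟩
  · rw [injective_iff_map_eq_zero]
    intro s hs
    obtain ⟨t, rfl⟩ := hS s
    obtain ⟨φ, hφ⟩ := hxC.exists_smul_eq (LinearMap.lsmul R C t) fun c => by
      rw [← QuotSMulTop.mkQ_eq_zero_iff]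
      exact LinearMap.congr_fun hs (Submodule.mkQ _ c)
    obtain ⟨r, rfl⟩ := hC.bijective.2 φ
    refine (hSx t).2 ⟨r, hC.bijective.1 ?_⟩
    rw [← hφ, ← smul_eq_mul, map_smul]
  · intro φ
    obtain ⟨ψ, hψ⟩ := (hC.extVanish 0).exists_lift_quotSMulTop hxC
      (φ.restrictScalars R ∘ₗ Submodule.mkQ _)
    obtain ⟨r, rfl⟩ := hC.bijective.2 ψ
    refine ⟨algebraMap R _ r, LinearMap.ext fun c => ?_⟩
    obtain ⟨c, rfl⟩ := Submodule.mkQ_surjective _ c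
    exact LinearMap.congr_fun hψ c
  · exact ExtVanish.descend hx hS hSx i (Submodule.mkQ _) (Submodule.mkQ_surjective _)
      (fun _ => QuotSMulTop.mkQ_eq_zero_iff) hxC
      ((hC.extVanish i).quotSMulTop hxC (hC.extVanish (i + 1)))

end Regular

section CoefficientField

variable {K A C : Type} [Field K] [CommRing A] [Algebra K A] [AddCommGroup C] [Module A C]
  [Module K C] [IsScalarTower K A C]

theorem Module.finite_of_surjective_residueField [IsLocalRing A] [IsArtinianRing A]
    (hK : Function.Surjective (algebraMap K (IsLocalRing.ResidueField A))) : Module.Finite K A := by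
  have : Module.Finite K (IsLocalRing.ResidueField A) :=
    Module.Finite.of_surjective (Algebra.linearMap K (IsLocalRing.ResidueField A)) hK
  refine Module.finite_of_surjective_of_ker_le_nilradical
    (IsScalarTower.toAlgHom K A (IsLocalRing.ResidueField A)) IsLocalRing.residue_surjective ?_
    (IsNoetherian.noetherian _)
  rw [Ring.KrullDimLE.nilradical_eq_maximalIdeal, ← IsLocalRing.ker_residue]
  rfl

theorem IsLocalRing.exists_maximalIdeal_smul_eq_zero [IsLocalRing A] [IsArtinianRing A]
    [Nontrivial C] : ∃ c : C, c ≠ 0 ∧ ∀ a ∈ IsLocalRing.maximalIdeal A, a • c = 0 := by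
  obtain ⟨p, hp⟩ := associatedPrimes.nonempty A C
  obtain ⟨hp, c, rfl⟩ := isAssociatedPrime_iff.1 hp
  have hmax := IsLocalRing.eq_maximalIdeal
    (IsArtinianRing.isMaximal_of_isPrime ((⊥ : Submodule A C).colon {c}))
  refine ⟨c, ?_, fun a ha => ?_⟩
  · rintro rfl
    exact hp.ne_top (by ext; simp [Submodule.mem_colon_singleton])
  · rw [← hmax] at ha
    simpa [Submodule.mem_colon_singleton] using ha

theorem finrank_quotient_le_finrank [IsLocalRing A] [IsArtinianRing A] [Module.Finite K A]
    (hK : Function.Surjective (algebraMap K (IsLocalRing.ResidueField A)))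
    (hC : Function.Bijective (LinearMap.lsmul A C)) :
    Module.finrank K (C ⧸ IsLocalRing.maximalIdeal A • (⊤ : Submodule A C)) ≤
      Module.finrank K A := by
  have : Nontrivial C := by
    by_contra h
    rw [not_nontrivial_iff_subsingleton] at h
    exact one_ne_zero (hC.1 (Subsingleton.elim (LinearMap.lsmul A C 1) (LinearMap.lsmul A C 0)))
  obtain ⟨c₀, hc₀, hm⟩ := IsLocalRing.exists_maximalIdeal_smul_eq_zero (A := A) (C := C)
  let V := C ⧸ IsLocalRing.maximalIdeal A • (⊤ : Submodule A C)
  let q : C →ₗ[A] V := Submodule.mkQ _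
  have hdec (a : A) : ∃ r : K, a - algebraMap K A r ∈ IsLocalRing.maximalIdeal A := by
    obtain ⟨r, hr⟩ := hK (IsLocalRing.residue A a)
    refine ⟨r, ?_⟩
    rw [← IsLocalRing.residue_eq_zero_iff, map_sub, ← hr, sub_eq_zero]
    rfl
  have key (ξ : Module.Dual K V) : ∃ a : A, ∀ c, a • c = ξ (q c) • c₀ := by
    let Φ : C →ₗ[A] C :=
      { toFun := fun c => ξ (q c) • c₀
        map_add' := fun c d => by simp [add_smul]
        map_smul' := fun a c => by
          obtain ⟨r, hr⟩ := hdec a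
          obtain ⟨s, rfl⟩ : ∃ s, s + algebraMap K A r = a := ⟨_, sub_add_cancel _ _⟩
          rw [add_sub_cancel_right] at hr
          have h1 : q (s • c) = 0 := by
            rw [← LinearMap.mem_ker, Submodule.ker_mkQ]
            exact Submodule.smul_mem_smul hr Submodule.mem_top
          simp only [RingHom.id_apply]
          rw [add_smul, map_add, h1, zero_add, algebraMap_smul, add_smul, algebraMap_smul,
            smul_comm s, hm s hr, smul_zero, zero_add, LinearMap.map_smul_of_tower, map_smul,
            smul_assoc] }
    obtain ⟨a, ha⟩ := hC.2 Φ
    exact ⟨a, LinearMap.congr_fun ha⟩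
  choose θ hθ using key
  have hinj {a b : A} (h : ∀ c : C, a • c = b • c) : a = b := hC.1 (LinearMap.ext h)
  let Θ : Module.Dual K V →ₗ[K] A :=
    { toFun := θ
      map_add' := fun ξ η => hinj fun c => by simp [add_smul, hθ]
      map_smul' := fun r ξ => hinj fun c => by simp [hθ, mul_smul] }
  have hΘ : Function.Injective Θ := by
    rw [injective_iff_map_eq_zero]
    intro ξ hξ
    refine LinearMap.ext fun v => ?_
    obtain ⟨c, rfl⟩ := Submodule.mkQ_surjective _ v
    have h1 := hθ ξ c
    rw [show θ ξ = 0 from hξ, zero_smul] at h1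
    exact (smul_eq_zero.1 h1.symm).resolve_right hc₀
  rw [← Subspace.dual_finrank_eq]
  exact LinearMap.finrank_le_finrank_of_injective hΘ

theorem finrank_le_finrank_sq [IsLocalRing A] [IsArtinianRing A] [Module.Finite K A]
    [Module.Finite A C]
    (hK : Function.Surjective (algebraMap K (IsLocalRing.ResidueField A)))
    (hC : Function.Bijective (LinearMap.lsmul A C)) :
    Module.finrank K C ≤ Module.finrank K A * Module.finrank K A := by
  have : Module.Finite K C := Module.Finite.trans A C
  let V := C ⧸ IsLocalRing.maximalIdeal A • (⊤ : Submodule A C)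
  let q : C →ₗ[A] V := Submodule.mkQ _
  have hq : Function.Surjective q := Submodule.mkQ_surjective _
  have : Module.Finite K V := Module.Finite.of_surjective (q.restrictScalars K) hq
  let b := Module.finBasis K V
  choose c hc using fun i => hq (b i)
  let f : (Fin (Module.finrank K V) → A) →ₗ[A] C := Fintype.linearCombination A c
  have hf : Function.Surjective f := by
    rw [← LinearMap.range_eq_top, ← top_le_iff]
    refine Submodule.le_of_le_smul_of_le_jacobson_bot (I := IsLocalRing.maximalIdeal A)
      Module.Finite.fg_top (IsLocalRing.maximalIdeal_le_jacobson _) fun d _ => ?_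
    let e := f fun i => algebraMap K A (b.repr (q d) i)
    have he : q e = q d := by
      conv_rhs => rw [← b.sum_repr (q d)]
      simp [e, f, Fintype.linearCombination_apply, hc]
    have h1 : d - e ∈ IsLocalRing.maximalIdeal A • (⊤ : Submodule A C) := by
      rw [← Submodule.ker_mkQ (IsLocalRing.maximalIdeal A • (⊤ : Submodule A C)),
        LinearMap.mem_ker, map_sub, sub_eq_zero]
      exact he.symm
    rw [← sub_add_cancel d e, add_comm]
    exact Submodule.add_mem_sup ⟨_, rfl⟩ h1
  calc Module.finrank K C ≤ Module.finrank K (Fin (Module.finrank K V) → A) :=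
        LinearMap.finrank_le_finrank_of_surjective (f := f.restrictScalars K) hf
    _ = Module.finrank K V * Module.finrank K A := by
        rw [Module.finrank_pi_fintype]; simp
    _ ≤ _ := Nat.mul_le_mul_right _ (finrank_quotient_le_finrank hK hC)

end CoefficientField

section Rigid

/-- The underlying group of the extension of `C` by itself attached to a derivation. -/
def DerivationExtension (C : Type) : Type := C × C

instance (C : Type) [AddCommGroup C] : AddCommGroup (DerivationExtension C) :=
  inferInstanceAs (AddCommGroup (C × C))

variable {K A C : Type} [Field K] [CommRing A] [Algebra K A] [AddCommGroup C] [Module A C]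
  [Module K C] [IsScalarTower K A C]

/-- If self-extensions split, then derivations with values in endomorphisms are inner. -/
theorem ExtVanish.exists_inner (h : ExtVanish A C C 1) (D : A →ₗ[K] Module.End K C)
    (hD : ∀ a b c, D (a * b) c = a • D b c + D a (b • c)) :
    ∃ θ : Module.End K C, ∀ a c, D a c = a • θ c - θ (a • c) := by
  have hD1 (c : C) : D 1 c = 0 := by simpa using hD 1 1 c
  let _ : Module A (DerivationExtension C) :=
    { smul := fun a p => (a • p.1 + D a p.2, a • p.2)
      one_smul := fun p => Prod.ext (show (1 : A) • p.1 + D 1 p.2 = p.1 by rw [hD1]; simp)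
        (one_smul A p.2)
      mul_smul := fun a b p => Prod.ext
        (show (a * b) • p.1 + D (a * b) p.2 = a • (b • p.1 + D b p.2) + D a (b • p.2) by
          rw [hD, mul_smul, smul_add, add_assoc]) (mul_smul a b p.2)
      smul_zero := fun a => Prod.ext (show a • (0 : C) + D a 0 = 0 by simp) (smul_zero a)
      smul_add := fun a p q => Prod.ext
        (show a • (p.1 + q.1) + D a (p.2 + q.2) = a • p.1 + D a p.2 + (a • q.1 + D a q.2) by
          rw [smul_add, map_add]; abel) (smul_add a p.2 q.2)
      add_smul := fun a b p => Prod.ext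
        (show (a + b) • p.1 + D (a + b) p.2 = a • p.1 + D a p.2 + (b • p.1 + D b p.2) by
          rw [add_smul, map_add, LinearMap.add_apply]; abel) (add_smul a b p.2)
      zero_smul := fun p => Prod.ext (show (0 : A) • p.1 + D 0 p.2 = 0 by simp) (zero_smul A p.2) }
  let f : C →ₗ[A] DerivationExtension C :=
    { toFun := fun c => (c, 0)
      map_add' := fun c d => Prod.ext rfl (add_zero (0 : C)).symm
      map_smul' := fun a c => Prod.ext (show a • c = a • c + D a 0 by simp) (smul_zero a).symm }
  let g : DerivationExtension C →ₗ[A] C :=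
    { toFun := fun p => p.2
      map_add' := fun _ _ => rfl
      map_smul' := fun _ _ => rfl }
  have hf : Function.Injective f := fun a b hab => congrArg Prod.fst hab
  have hg : Function.Surjective g := fun c => ⟨((0, c) : C × C), rfl⟩
  have hfg : Function.Exact f g := fun p =>
    ⟨fun hp => ⟨p.1, Prod.ext rfl (Eq.symm hp)⟩, by rintro ⟨c, rfl⟩; rfl⟩
  obtain ⟨ψ, hψ⟩ := h.exists_extend hf hg hfg LinearMap.id
  let ι (c : C) : DerivationExtension C := ((0, c) : C × C)
  have hι (a : A) (c : C) : ψ (ι (a • c)) = a • ψ (ι c) - D a c := by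
    have h1 : a • ι c = f (D a c) + ι (a • c) :=
      Prod.ext (show a • (0 : C) + D a c = D a c + 0 by simp) (zero_add (a • c)).symm
    rw [← map_smul, h1, map_add, show ψ (f (D a c)) = D a c from LinearMap.congr_fun hψ _,
      add_sub_cancel_left]
  let θ : Module.End K C :=
    { toFun := fun c => ψ (ι c)
      map_add' := fun c d => by
        rw [← map_add]
        exact congrArg ψ (Prod.ext (zero_add (0 : C)).symm rfl)
      map_smul' := fun r c => by
        rw [RingHom.id_apply, ← algebraMap_smul A r c, hι, algebraMap_smul,
          Algebra.algebraMap_eq_smul_one, map_smul, LinearMap.smul_apply, hD1, smul_zero,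
          sub_zero] }
  refine ⟨θ, fun a c => ?_⟩
  rw [show θ (a • c) = _ from hι a c]
  exact (sub_sub_cancel _ _).symm

/-- The matrix representation of a module with a basis. -/
noncomputable def basisRep {n : Type} [Fintype n] [DecidableEq n] (b : Module.Basis n K C) :
    A →ₐ[K] Matrix n n K :=
  (LinearMap.toMatrixAlgEquiv b).toAlgHom.comp (Algebra.lsmul K K C)

theorem equivFun_symm_basisRep_mulVec {n : Type} [Fintype n] [DecidableEq n]
    (b : Module.Basis n K C) (a : A) (v : n → K) :
    b.equivFun.symm ((basisRep b a).mulVec v) = a • b.equivFun.symm v := by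
  rw [LinearEquiv.symm_apply_eq]
  have := LinearMap.toMatrix_mulVec_repr b b (Algebra.lsmul K K C a) (b.equivFun.symm v)
  rw [← b.equivFun_apply, LinearEquiv.apply_symm_apply] at this
  exact this

theorem ExtVanish.isRigidRep_basisRep {n : Type} [Fintype n] [DecidableEq n]
    (h : ExtVanish A C C 1) (b : Module.Basis n K C) :
    IsRigidRep (basisRep b : A →ₐ[K] Matrix n n K) := by
  intro D hD
  let e := LinearMap.toMatrixAlgEquiv b
  obtain ⟨θ, hθ⟩ := h.exists_inner (e.symm.toLinearMap ∘ₗ D) fun a a' c => by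
    have h1 : e.symm (D (a * a')) =
        Algebra.lsmul K K C a * e.symm (D a') + e.symm (D a) * Algebra.lsmul K K C a' := by
      rw [AlgEquiv.symm_apply_eq, hD, map_add, map_mul, map_mul, AlgEquiv.apply_symm_apply,
        AlgEquiv.apply_symm_apply]
      rfl
    exact LinearMap.congr_fun h1 c
  refine ⟨- e θ, fun a => ?_⟩
  have h1 : e.symm (D a) = Algebra.lsmul K K C a * θ - θ * Algebra.lsmul K K C a :=
    LinearMap.ext (hθ a)
  rw [AlgEquiv.symm_apply_eq, map_sub, map_mul, map_mul] at h1
  rw [h1]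
  change basisRep b a * _ - _ * basisRep b a = _
  rw [neg_mul, mul_neg]
  abel

end Rigid

/-- There are only finitely many isomorphism classes of semidualizing modules. -/
def HasFinitelyManySemidualizing (R : Type) [CommRing R] : Prop :=
  ∃ (ι : Type) (_ : Finite ι) (P : ModuleCat.{0} R → ι → Prop),
    (∀ C : ModuleCat.{0} R, IsSemidualizingModule R C → ∃ i, P C i) ∧
    ∀ (C D : ModuleCat.{0} R) (i : ι), IsSemidualizingModule R C → IsSemidualizingModule R D →
      P C i → P D i → Nonempty (C ≃ₗ[R] D)

theorem HasFinitelyManySemidualizing.of_coefficient_field {K A : Type} [Field K] [CommRing A]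
    [Algebra K A] [IsLocalRing A] [IsArtinianRing A]
    (hK : Function.Surjective (algebraMap K (IsLocalRing.ResidueField A))) :
    HasFinitelyManySemidualizing A := by
  have := Module.finite_of_surjective_residueField hK
  choose t ht hrep using fun n : ℕ => finite_rigid_reps K A (Fin n)
  have (n : ℕ) : Finite (t n) := ht n
  let N := Module.finrank K A * Module.finrank K A
  refine ⟨Σ n : Fin (N + 1), t n, inferInstance, fun C i =>
    ∃ e : (Fin i.1 → K) ≃+ C, ∀ a v, e ((i.2.1 a).mulVec v) = a • e v, fun C hC => ?_, ?_⟩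
  · let _ : Module K C := Module.compHom C (algebraMap K A)
    have : IsScalarTower K A C := ⟨fun r a c => by rw [Algebra.smul_def, mul_smul]; rfl⟩
    have := hC.finite
    have : Module.Finite K C := Module.Finite.trans A C
    let b := Module.finBasis K C
    obtain ⟨x, hx, P, hP, hPx⟩ := hrep _ _ ((hC.extVanish 0).isRigidRep_basisRep b)
    refine ⟨⟨⟨Module.finrank K C, Nat.lt_succ_of_le (finrank_le_finrank_sq hK hC.bijective)⟩,
      ⟨x, hx⟩⟩, ((P.toLinearEquiv' (P.invertibleOfIsUnitDet hP)).trans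
        b.equivFun.symm).toAddEquiv, fun a v => ?_⟩
    change b.equivFun.symm (P.mulVec ((x a).mulVec v)) = a • b.equivFun.symm (P.mulVec v)
    rw [Matrix.mulVec_mulVec, hPx, ← Matrix.mulVec_mulVec, equivFun_symm_basisRep_mulVec]
  · rintro C D i - - ⟨e, he⟩ ⟨e', he'⟩
    refine ⟨(e.symm.trans e').toLinearEquiv fun a c => ?_⟩
    obtain ⟨v, rfl⟩ := e.surjective c
    simp [← he, ← he']

theorem HasFinitelyManySemidualizing.of_quotient {R : Type} [CommRing R] [IsNoetherianRing R]
    [IsLocalRing R] {x : R} (hxm : x ∈ IsLocalRing.maximalIdeal R) (hx : IsSMulRegular R x)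
    (h : HasFinitelyManySemidualizing (R ⧸ Ideal.span {x})) : HasFinitelyManySemidualizing R := by
  obtain ⟨ι, hι, P, hP, hPP⟩ := h
  refine ⟨ι, hι, fun C i => P (ModuleCat.of _ (QuotSMulTop x C)) i,
    fun C hC => hP _ (hC.quotSMulTop hx), fun C D i hC hD hCi hDi => ?_⟩
  obtain ⟨e⟩ := hPP _ _ i (hC.quotSMulTop hx) (hD.quotSMulTop hx) hCi hDi
  exact hC.nonempty_linearEquiv hD hxm hx (e.restrictScalars R)

open scoped Pointwise in
/-- Finiteness passes up along a regular sequence with artinian quotient. -/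
theorem HasFinitelyManySemidualizing.of_isWeaklyRegular (n : ℕ) (R : Type) [CommRing R]
    [IsNoetherianRing R] [IsLocalRing R]
    (hfield : ∃ (k : Type) (_ : Field k), Nonempty (k →+* R)) (hdim : ringKrullDim R = n)
    (rs : List R) (hlen : rs.length = n) (hrs : ∀ r ∈ rs, r ∈ IsLocalRing.maximalIdeal R)
    (hreg : RingTheory.Sequence.IsWeaklyRegular R rs) : HasFinitelyManySemidualizing R := by
  induction n generalizing R with
  | zero =>
    have : Ring.KrullDimLE 0 R := (Ring.krullDimLE_iff).2 hdim.le
    have : IsArtinianRing R := isArtinianRing_iff_isNoetherianRing_krullDimLE_zero.2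
      ⟨inferInstance, this⟩
    obtain ⟨s, hs⟩ := IsLocalRing.exists_coefficient_field R hfield
    let _ : Algebra (IsLocalRing.ResidueField R) R := s.toAlgebra
    exact .of_coefficient_field (K := IsLocalRing.ResidueField R)
      fun a => ⟨a, RingHom.congr_fun hs a⟩
  | succ n ih =>
    cases rs with
    | nil => simp at hlen
    | cons x rs =>
      have hxm : x ∈ IsLocalRing.maximalIdeal R := hrs x (by simp)
      rw [RingTheory.Sequence.isWeaklyRegular_cons_iff'] at hreg
      obtain ⟨hx, hreg⟩ := hreg
      have hne : Ideal.span {x} ≠ ⊤ := by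
        rw [ne_eq, Ideal.span_singleton_eq_top]
        exact hxm
      have : Nontrivial (R ⧸ Ideal.span {x}) := Ideal.Quotient.nontrivial_iff.2 hne
      have : IsLocalRing (R ⧸ Ideal.span {x}) :=
        .of_surjective' (Ideal.Quotient.mk _) Ideal.Quotient.mk_surjective
      refine .of_quotient hxm hx (ih _ ?_ ?_ (rs.map (Ideal.Quotient.mk _)) (by simpa using hlen)
        ?_ ?_)
      · obtain ⟨k, hk, ⟨i⟩⟩ := hfield
        exact ⟨k, hk, ⟨(Ideal.Quotient.mk _).comp i⟩⟩
      · have := ringKrullDim_quotient_span_singleton_succ_eq_ringKrullDim hx hxm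
        rw [hdim, Nat.cast_succ] at this
        exact ENat.WithBot.add_one_cancel.1 this
      · intro r hr
        obtain ⟨r, hr', rfl⟩ := List.mem_map.1 hr
        rw [← IsLocalRing.map_maximalIdeal_of_surjective _ Ideal.Quotient.mk_surjective]
        exact Ideal.mem_map_of_mem _ (hrs r (List.mem_cons_of_mem x hr'))
      · have h : x • (⊤ : Submodule R R) = Ideal.span {x} := by
          rw [← Submodule.ideal_span_singleton_smul, smul_eq_mul, Ideal.mul_top]
        let e : QuotSMulTop x R ≃ₗ[R] R ⧸ Ideal.span {x} := Submodule.quotEquivOfEq _ _ h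
        exact ((e.extendScalarsOfSurjective Ideal.Quotient.mk_surjective).isWeaklyRegular_congr
          _).1 hreg

/-- A Cohen–Macaulay noetherian local ring containing a field has only finitely many
semidualizing modules up to isomorphism. -/
theorem finitely_many_semidualizing_modules_of_cohenMacaulay
    (R : Type) [CommRing R] [IsNoetherianRing R] [IsLocalRing R]
    (hCM : IsCohenMacaulayLocal R)
    (hfield : ∃ (k : Type) (_ : Field k), Nonempty (k →+* R)) :
    ∃ T : Set (ModuleCat R), T.Finite ∧
      ∀ C : ModuleCat R, IsSemidualizing R C → ∃ D ∈ T, Nonempty (C ≃ₗ[R] D) := by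
  obtain ⟨d, hdim, hext⟩ := hCM
  let k := IsLocalRing.ResidueField R
  obtain ⟨rs, hlen, hmem, hreg⟩ := ModuleCat.exists_isRegular_of_exists_subsingleton_ext
    (IsLocalRing.maximalIdeal R) d (ModuleCat.of R R)
    (by
      rw [smul_eq_mul, Ideal.mul_top]
      exact (IsLocalRing.maximalIdeal.isMaximal R).ne_top.lt_top)
    (ModuleCat.of R k)
    (by
      change Module.support R k = _
      rw [Module.support_eq_zeroLocus]
      exact congrArg _ (congrArg _ Ideal.annihilator_quotient))
    (fun i hi => subsingleton_abelianExt_of_subsingleton R _ _ i (hext i hi))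
  obtain ⟨ι, _, P, hP, hPP⟩ := HasFinitelyManySemidualizing.of_isWeaklyRegular d R hfield hdim rs
    hlen hmem hreg.toIsWeaklyRegular
  have hsd (C : ModuleCat R) (hC : IsSemidualizing R C) : IsSemidualizingModule R C :=
    ⟨hC.1, hC.2.1, fun i => subsingleton_abelianExt_of_subsingleton R _ _ (i + 1)
      (hC.2.2 (i + 1) i.succ_pos)⟩
  let J := {i : ι // ∃ C : ModuleCat R, IsSemidualizingModule R C ∧ P C i}
  let rep (i : J) : ModuleCat R := i.2.choose
  refine ⟨Set.range fun i => ModuleCat.of R (ULift (rep i)), Set.finite_range _, fun C hC => ?_⟩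
  obtain ⟨i, hi⟩ := hP C (hsd C hC)
  let j : J := ⟨i, C, hsd C hC, hi⟩
  obtain ⟨e⟩ := hPP C (rep j) i (hsd C hC) j.2.choose_spec.1 hi j.2.choose_spec.2
  exact ⟨_, ⟨j, rfl⟩, ⟨e.trans ULift.moduleEquiv.symm⟩⟩
end

section
/- Let (R, m) be a commutative noetherian local ring and let C be a semidualizing R-module of finite projective dimension. Then C is free of rank 1, i.e., C ≅ R. -/
/-!
STATEMENT 6: Over a commutative noetherian local ring, a semidualizing module of
finite projective dimension is free of rank 1, i.e. C ≅ R.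
-/

open CategoryTheory

/-- An `R`-module `C` has finite projective dimension iff there is `n` such that
`Ext^i_R(C, N) = 0` for every module `N` and every `i > n`. -/
def HasFiniteProjectiveDimension (R : Type) [CommRing R] (C : ModuleCat R) : Prop :=
  ∃ n : ℕ, ∀ (N : ModuleCat R) (i : ℕ), n < i → Subsingleton (extMod R C N i)

open Abelian IsLocalRing TensorProduct

/-- Vanishing of the derived-functor `Ext` in positive degree implies vanishing of the
derived-category `Ext`. -/
lemma subsingleton_ext_of_subsingleton_extMod {R : Type} [CommRing R] (M N : ModuleCat R) (i : ℕ)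
    (h : Subsingleton (extMod R M N (i + 1))) : Subsingleton (Abelian.Ext M N (i + 1)) := by
  let P := projectiveResolution M
  have hz : Limits.IsZero ((P.complex.linearYonedaObj R N).homology (i + 1)) :=
    ((extMod R M N (i + 1)).isZero_of_subsingleton).of_iso (P.isoExt (i + 1) N).symm
  rw [← HomologicalComplex.exactAt_iff_isZero_homology,
    HomologicalComplex.exactAt_iff' _ i (i + 1) (i + 2) (by simp) (by simp),
    ShortComplex.moduleCat_exact_iff] at hz
  refine subsingleton_of_forall_eq 0 fun e ↦ ?_
  obtain ⟨f, hf, rfl⟩ := P.extMk_surjective e (i + 2) rfl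
  rw [P.extMk_eq_zero_iff f (i + 2) rfl hf i rfl]
  exact hz f hf

/-- A finitely generated module over a local ring has a finite free cover whose kernel lies in
the maximal ideal times the cover. -/
lemma exists_minimal_free_cover (R : Type) [CommRing R] [IsLocalRing R]
    (M : Type) [AddCommGroup M] [Module R M] [Module.Finite R M] :
    ∃ (n : ℕ) (f : (Fin n → R) →ₗ[R] M), Function.Surjective f ∧
      LinearMap.ker f ≤ maximalIdeal R • ⊤ := by
  let b := Module.finBasis (ResidueField R) (ResidueField R ⊗[R] M)
  choose m hm using fun i ↦ TensorProduct.mk_surjective R M (ResidueField R)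
    Ideal.Quotient.mk_surjective (b i)
  refine ⟨_, Fintype.linearCombination R m, ?_, fun x hx ↦ ?_⟩
  · rw [← LinearMap.range_eq_top, Fintype.range_linearCombination]
    exact span_eq_top_of_tmul_eq_basis m b hm
  · have h0 : ∑ i, residue R (x i) • b i = 0 := by
      have := congrArg (TensorProduct.mk R (ResidueField R) M 1) (LinearMap.mem_ker.mp hx)
      simpa [Fintype.linearCombination_apply, TensorProduct.tmul_sum, ← hm,
        TensorProduct.tmul_smul, TensorProduct.smul_tmul', Algebra.smul_def] using this
    have h1 := Fintype.linearIndependent_iff.mp b.linearIndependent _ h0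
    rw [pi_eq_sum_univ' x]
    exact Submodule.sum_mem _ fun i _ ↦ Submodule.smul_mem_smul
      ((residue_eq_zero_iff _).mp (h1 i)) Submodule.mem_top

/-- Over a noetherian local ring, a finitely generated module of finite projective dimension
whose positive `Ext` into some nonzero finitely generated module vanishes is free. -/
lemma free_of_subsingleton_ext {R : Type} [CommRing R] [IsNoetherianRing R] [IsLocalRing R]
    (N : ModuleCat R) [Module.Finite R N] [Nontrivial N] (n : ℕ) (M : ModuleCat R)
    [Module.Finite R M] [HasProjectiveDimensionLT M (n + 1)]
    (h : ∀ i, Subsingleton (Abelian.Ext M N (i + 1))) : Module.Free R M := by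
  induction n generalizing M with
  | zero =>
    have : Module.Projective R M := by
      rw [IsProjective.iff_projective]
      exact (projective_iff_hasProjectiveDimensionLT_one (X := M)).mpr inferInstance
    exact Module.free_of_flat_of_isLocalRing
  | succ n ih =>
    obtain ⟨r, f, hf, hker⟩ := exists_minimal_free_cover R M
    let S : ShortComplex (ModuleCat R) := f.shortComplexKer
    have hS : S.ShortExact := LinearMap.shortExact_shortComplexKer hf
    have : Module.Free R S.X₂ := inferInstanceAs (Module.Free R (Fin r → R))
    have hpr : Projective S.X₂ := ModuleCat.projective_of_free (Module.Free.chooseBasis R S.X₂)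
    have : Module.Finite R S.X₁ := inferInstanceAs (Module.Finite R (LinearMap.ker f))
    have : HasProjectiveDimensionLT S.X₁ (n + 1) :=
      (hS.hasProjectiveDimensionLT_X₃_iff n hpr).mp ‹_›
    have hfree : Module.Free R S.X₁ := by
      refine ih S.X₁ fun i ↦ subsingleton_of_forall_eq 0 fun e ↦ ?_
      have h2 : Subsingleton (Abelian.Ext S.X₂ N (i + 1)) := Ext.subsingleton_of_projective S.X₂ N i
      obtain ⟨e', rfl⟩ := Ext.contravariant_sequence_exact₁ hS N e (add_comm 1 (i + 1))
        ((h (i + 1)).elim _ _)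
      rw [h2.elim e' 0, Ext.comp_zero]
    have hsub : Subsingleton S.X₁ := by
      by_contra hne
      rw [not_subsingleton_iff_nontrivial] at hne
      let b := Module.Free.chooseBasis R S.X₁
      obtain ⟨j⟩ := b.index_nonempty
      have htop : (⊤ : Submodule R N) ≤ maximalIdeal R • ⊤ := fun y _ ↦ by
        let φ : S.X₁ ⟶ N := ModuleCat.ofHom (b.constr R fun _ ↦ y)
        obtain ⟨e, he⟩ := Ext.contravariant_sequence_exact₁ hS N (Ext.mk₀ φ) (add_zero 1)
          ((h 0).elim _ _)
        obtain ⟨ψ, rfl⟩ := (Ext.mk₀_bijective _ _).2 e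
        rw [Ext.mk₀_comp_mk₀, (Ext.mk₀_bijective _ _).1.eq_iff] at he
        have hy : ψ.hom (S.f.hom (b j)) = y :=
          (congrArg (fun g ↦ g.hom (b j)) he).trans (b.constr_basis R _ j)
        have hmem : S.f.hom (b j) ∈ (maximalIdeal R • ⊤ : Submodule R S.X₂) := hker (b j).2
        have := Submodule.mem_map_of_mem (f := ψ.hom) hmem
        rw [Submodule.map_smul'', hy] at this
        exact Submodule.smul_mono le_rfl le_top this
      have := Submodule.eq_bot_of_le_smul_of_le_jacobson_bot _ _ Module.Finite.fg_top htop
        (maximalIdeal_le_jacobson _)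
      exact top_ne_bot this
    have hinj : Function.Injective f := by
      rw [← LinearMap.ker_eq_bot]
      exact Submodule.subsingleton_iff_eq_bot.mp hsub
    exact Module.Free.of_equiv (LinearEquiv.ofBijective f ⟨hinj, hf⟩)

/-- A semidualizing module of finite projective dimension over a noetherian local ring
is free of rank one. -/
theorem semidualizing_of_finite_projective_dimension
    (R : Type) [CommRing R] [IsNoetherianRing R] [IsLocalRing R]
    (C : Type) [AddCommGroup C] [Module R C]
    (hC : IsSemidualizing R C)
    (hpd : HasFiniteProjectiveDimension R (ModuleCat.of R C)) :
    Nonempty (C ≃ₗ[R] R) := by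
  obtain ⟨hfin, hbij, hext⟩ := hC
  have hCnt : Nontrivial C := by
    by_contra hne
    rw [not_nontrivial_iff_subsingleton] at hne
    exact one_ne_zero (hbij.1 (Subsingleton.elim (LinearMap.lsmul R C 1) (LinearMap.lsmul R C 0)))
  obtain ⟨n, hn⟩ := hpd
  have : HasProjectiveDimensionLT (ModuleCat.of R C) (n + 1) := by
    refine (hasProjectiveDimensionLT_iff _ _).mpr fun i hi Y e ↦ ?_
    obtain ⟨i, rfl⟩ := Nat.exists_eq_add_of_le' (Nat.one_le_of_lt hi)
    exact (subsingleton_ext_of_subsingleton_extMod _ _ i (hn Y _ hi)).elim _ _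
  have hfree : Module.Free R C := free_of_subsingleton_ext (ModuleCat.of R C) n (ModuleCat.of R C)
    fun i ↦ subsingleton_ext_of_subsingleton_extMod _ _ i (hext _ (Nat.le_add_left 1 i))
  have hrank : Module.finrank R C = 1 := by
    have h1 := (LinearEquiv.ofBijective (LinearMap.lsmul R C) hbij).finrank_eq
    rw [Module.finrank_self, Module.finrank_linearMap] at h1
    exact Nat.eq_one_of_mul_eq_one_right h1.symm
  exact ⟨LinearEquiv.ofFinrankEq C R (hrank.trans (Module.finrank_self R).symm)⟩
end

section
/- Let φ: R → S be a flat ring homomorphism of commutative noetherian rings. If C is a semidualizing R-module, then S ⊗_R C is a semidualizing S-module. If moreover φ is faithfully flat (e.g., flat local), then the converse holds: if S ⊗_R C is a semidualizing S-module for a finitely generated R-module C, then C is a semidualizing R-module. -/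
/-!
STATEMENT 8: For a flat homomorphism R → S of commutative noetherian rings, base
change S ⊗_R C of a semidualizing R-module C is semidualizing over S; conversely,
if the homomorphism is faithfully flat and S ⊗_R C is semidualizing over S for a
finitely generated R-module C, then C is semidualizing over R.
-/

open CategoryTheory TensorProduct

open CategoryTheory.Abelian in
/-- The left derived functor and derived category versions of `Ext` vanish simultaneously. -/
theorem subsingleton_extMod_succ_iff {R : Type} [CommRing R] (M N : ModuleCat.{0} R) (n : ℕ) :
    Subsingleton (extMod R M N (n + 1)) ↔ Subsingleton (Abelian.Ext.{0} M N (n + 1)) := by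
  let P := projectiveResolution M
  trans ∀ f : P.complex.X (n + 1) ⟶ N, P.complex.d (n + 2) (n + 1) ≫ f = 0 →
    ∃ g : P.complex.X n ⟶ N, P.complex.d (n + 1) n ≫ g = f
  · rw [extMod, (P.isoExt (R := R) (n + 1) N).toLinearEquiv.toEquiv.subsingleton_congr,
      ← ModuleCat.isZero_iff_subsingleton, ← HomologicalComplex.exactAt_iff_isZero_homology,
      HomologicalComplex.exactAt_iff' _ n (n + 1) (n + 2) (by simp) (by simp),
      ShortComplex.moduleCat_exact_iff]
    rfl
  · constructor
    · refine fun h ↦ subsingleton_of_forall_eq 0 fun x ↦ ?_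
      obtain ⟨f, hf, rfl⟩ := P.extMk_surjective x (n + 2) rfl
      exact (P.extMk_eq_zero_iff f _ rfl hf n rfl).2 (h f hf)
    · exact fun _ f hf ↦ (P.extMk_eq_zero_iff f _ rfl hf n rfl).1 (Subsingleton.elim _ _)

section ShortExact

open CategoryTheory.Abelian

variable {R : Type} [CommRing R] {T : ShortComplex (ModuleCat.{0} R)}

theorem CategoryTheory.ShortComplex.ShortExact.subsingleton_ext_one_iff (hT : T.ShortExact)
    [Projective T.X₂] (N : ModuleCat.{0} R) :
    Subsingleton (Abelian.Ext.{0} T.X₃ N 1) ↔ Function.Surjective (T.f.hom.lcomp R N) := by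
  constructor
  · intro _ f
    obtain ⟨x, hx⟩ := Ext.contravariant_sequence_exact₁ hT N (Ext.mk₀ (ModuleCat.ofHom f))
      (add_comm 1 0) (Subsingleton.elim _ _)
    obtain ⟨g, rfl⟩ := (Ext.mk₀_bijective _ _).2 x
    rw [Ext.mk₀_comp_mk₀] at hx
    exact ⟨g.hom, congr_arg ModuleCat.Hom.hom ((Ext.mk₀_bijective _ _).1 hx)⟩
  · refine fun h ↦ subsingleton_of_forall_eq 0 fun x ↦ ?_
    obtain ⟨y, rfl⟩ := precomp_extClass_surjective_of_projective_X₂ N hT 0 x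
    obtain ⟨f, rfl⟩ := (Ext.mk₀_bijective _ _).2 y
    obtain ⟨g, hg⟩ := h f.hom
    have : f = T.f ≫ ModuleCat.ofHom g := ModuleCat.hom_ext hg.symm
    simp [this, ← Ext.mk₀_comp_mk₀]

theorem CategoryTheory.ShortComplex.ShortExact.subsingleton_ext_succ_iff (hT : T.ShortExact)
    [Projective T.X₂] (N : ModuleCat.{0} R) (n : ℕ) :
    Subsingleton (Abelian.Ext.{0} T.X₃ N (n + 2)) ↔
      Subsingleton (Abelian.Ext.{0} T.X₁ N (n + 1)) := by
  constructor
  · refine fun _ ↦ subsingleton_of_forall_eq 0 fun x ↦ ?_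
    obtain ⟨y, rfl⟩ := Ext.contravariant_sequence_exact₁ hT N x
      (add_comm 1 (n + 1)) (Subsingleton.elim _ _)
    rw [Ext.eq_zero_of_projective y, Ext.comp_zero]
  · exact fun _ ↦ (precomp_extClass_surjective_of_projective_X₂ N hT (n + 1)).subsingleton

end ShortExact

section BaseChange

open CategoryTheory.Abelian Module

variable {R : Type} (S : Type) [CommRing R] [CommRing S] [Algebra R S]

theorem IsBaseChange.comp_equiv_eq_equiv_comp_lTensor
    {M M' N N' : Type} [AddCommMonoid M] [Module R M] [AddCommMonoid N] [Module R N]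
    [AddCommMonoid M'] [Module R M'] [Module S M'] [IsScalarTower R S M']
    [AddCommMonoid N'] [Module R N'] [Module S N'] [IsScalarTower R S N']
    {a : M →ₗ[R] M'} (ha : IsBaseChange S a) {b : N →ₗ[R] N'} (hb : IsBaseChange S b)
    {f : M →ₗ[R] N} {f' : M' →ₗ[S] N'} (h : ∀ x, f' (a x) = b (f x)) :
    f' ∘ ha.equiv = hb.equiv ∘ f.lTensor S := by
  funext x
  dsimp only [Function.comp_apply]
  induction x with
  | zero => simp
  | tmul s m => simp [IsBaseChange.equiv_tmul, h]
  | add x y hx hy => simp only [map_add, hx, hy]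

theorem IsBaseChange.surjective_iff_lTensor
    {M M' N N' : Type} [AddCommMonoid M] [Module R M] [AddCommMonoid N] [Module R N]
    [AddCommMonoid M'] [Module R M'] [Module S M'] [IsScalarTower R S M']
    [AddCommMonoid N'] [Module R N'] [Module S N'] [IsScalarTower R S N']
    {a : M →ₗ[R] M'} (ha : IsBaseChange S a) {b : N →ₗ[R] N'} (hb : IsBaseChange S b)
    {f : M →ₗ[R] N} {f' : M' →ₗ[S] N'} (h : ∀ x, f' (a x) = b (f x)) :
    Function.Surjective f' ↔ Function.Surjective (f.lTensor S) := by
  rw [← ha.equiv.surjective.of_comp_iff f', ha.comp_equiv_eq_equiv_comp_lTensor S hb h]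
  exact hb.equiv.toEquiv.comp_surjective (f.lTensor S)

theorem IsBaseChange.bijective_iff_lTensor
    {M M' N N' : Type} [AddCommMonoid M] [Module R M] [AddCommMonoid N] [Module R N]
    [AddCommMonoid M'] [Module R M'] [Module S M'] [IsScalarTower R S M']
    [AddCommMonoid N'] [Module R N'] [Module S N'] [IsScalarTower R S N']
    {a : M →ₗ[R] M'} (ha : IsBaseChange S a) {b : N →ₗ[R] N'} (hb : IsBaseChange S b)
    {f : M →ₗ[R] N} {f' : M' →ₗ[S] N'} (h : ∀ x, f' (a x) = b (f x)) :
    Function.Bijective f' ↔ Function.Bijective (f.lTensor S) := by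
  rw [← Function.Bijective.of_comp_iff f' ha.equiv.bijective,
    ha.comp_equiv_eq_equiv_comp_lTensor S hb h]
  exact hb.equiv.toEquiv.comp_bijective (f.lTensor S)

/-- The base change to `S` of a short complex of `R`-modules. -/
noncomputable def CategoryTheory.ShortComplex.baseChange (T : ShortComplex (ModuleCat.{0} R)) :
    ShortComplex (ModuleCat.{0} S) :=
  .mk (X₁ := .of S (S ⊗[R] T.X₁)) (X₂ := .of S (S ⊗[R] T.X₂)) (X₃ := .of S (S ⊗[R] T.X₃))
    (ModuleCat.ofHom (T.f.hom.baseChange S)) (ModuleCat.ofHom (T.g.hom.baseChange S)) <| by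
      rw [← ModuleCat.ofHom_comp, ← LinearMap.baseChange_comp, ← ModuleCat.hom_comp, T.zero]
      simp

variable [Module.Flat R S]

theorem CategoryTheory.ShortComplex.ShortExact.baseChange {T : ShortComplex (ModuleCat.{0} R)}
    (hT : T.ShortExact) : (T.baseChange S).ShortExact where
  exact := by
    rw [ShortComplex.ShortExact.moduleCat_exact_iff_function_exact]
    exact Flat.lTensor_exact S
      ((ShortComplex.ShortExact.moduleCat_exact_iff_function_exact T).1 hT.exact)
  mono_f := (ModuleCat.mono_iff_injective _).2
    (Flat.lTensor_preserves_injective_linearMap _ hT.moduleCat_injective_f)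
  epi_g := (ModuleCat.epi_iff_surjective _).2
    (LinearMap.lTensor_surjective S hT.moduleCat_surjective_g)

/-- For `S` flat and `f : K → F` between finitely presented modules,
`Hom(S ⊗ F, S ⊗ N) → Hom(S ⊗ K, S ⊗ N)` is surjective if and only if
`S ⊗ Hom(F, N) → S ⊗ Hom(K, N)` is. -/
theorem LinearMap.surjective_lcomp_baseChange_iff {K F : Type} [AddCommGroup K] [Module R K]
    [AddCommGroup F] [Module R F] [Module.FinitePresentation R K] [Module.FinitePresentation R F]
    (f : K →ₗ[R] F) (N : Type) [AddCommGroup N] [Module R N] :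
    Function.Surjective ((f.baseChange S).lcomp S (S ⊗[R] N)) ↔
      Function.Surjective ((f.lcomp R N).lTensor S) :=
  IsBaseChange.surjective_iff_lTensor S (FinitePresentation.isBaseChange_map R F N S)
    (FinitePresentation.isBaseChange_map R K N S) (f := f.lcomp R N)
    (f' := (f.baseChange S).lcomp S (S ⊗[R] N)) fun x ↦ (LinearMap.baseChange_comp f x).symm

/-- Vanishing of `Ext` in a positive degree ascends along flat base change when the first argument
is finitely generated, and descends when the base change is faithfully flat. -/
theorem subsingleton_ext_baseChange [IsNoetherianRing R] (N : Type) [AddCommGroup N] [Module R N]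
    (n : ℕ) (M : Type) [AddCommGroup M] [Module R M] [Module.Finite R M] :
    (Subsingleton (Abelian.Ext.{0} (ModuleCat.of R M) (ModuleCat.of R N) (n + 1)) →
      Subsingleton (Abelian.Ext.{0} (ModuleCat.of S (S ⊗[R] M)) (ModuleCat.of S (S ⊗[R] N))
        (n + 1))) ∧
    (Module.FaithfullyFlat R S →
      Subsingleton (Abelian.Ext.{0} (ModuleCat.of S (S ⊗[R] M)) (ModuleCat.of S (S ⊗[R] N))
        (n + 1)) →
      Subsingleton (Abelian.Ext.{0} (ModuleCat.of R M) (ModuleCat.of R N) (n + 1))) := by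
  induction n using Nat.strong_induction_on generalizing M with | _ n ih =>
  obtain ⟨k, f, hf⟩ := Module.Finite.exists_fin' R M
  have hT := LinearMap.shortExact_shortComplexKer hf
  have : Projective f.shortComplexKer.X₂ := ModuleCat.projective_of_free (Pi.basisFun R (Fin k))
  have : Projective (f.shortComplexKer.baseChange S).X₂ :=
    ModuleCat.projective_of_free ((Pi.basisFun R (Fin k)).baseChange S)
  cases n with
  | zero =>
    have hR := hT.subsingleton_ext_one_iff (ModuleCat.of R N)
    have hS := (hT.baseChange S).subsingleton_ext_one_iff (ModuleCat.of S (S ⊗[R] N))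
    have := Module.finitePresentation_of_finite R (LinearMap.ker f)
    have key := (LinearMap.ker f).subtype.surjective_lcomp_baseChange_iff S N
    exact ⟨fun h ↦ hS.2 (key.2 (LinearMap.lTensor_surjective S (hR.1 h))),
      fun _ h ↦ hR.2 ((FaithfullyFlat.lTensor_surjective_iff_surjective R S _).1
        (key.1 (hS.1 h)))⟩
  | succ n =>
    have hR := hT.subsingleton_ext_succ_iff (ModuleCat.of R N) n
    have hS := (hT.baseChange S).subsingleton_ext_succ_iff (ModuleCat.of S (S ⊗[R] N)) n
    have := ih n n.lt_succ_self (LinearMap.ker f)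
    exact ⟨fun h ↦ hS.2 (this.1 (hR.1 h)), fun hs h ↦ hR.2 (this.2 hs (hS.1 h))⟩

/-- The homothety map of `S ⊗ C` is bijective if and only if the base change of that of `C` is. -/
theorem bijective_lsmul_baseChange_iff (C : Type) [AddCommGroup C] [Module R C]
    [Module.FinitePresentation R C] :
    Function.Bijective (LinearMap.lsmul S (S ⊗[R] C)) ↔
      Function.Bijective ((LinearMap.lsmul R C).lTensor S) := by
  have h (r : R) : LinearMap.lsmul S (S ⊗[R] C) (Algebra.linearMap R S r) =
      LinearMap.baseChangeHom R S C C (LinearMap.lsmul R C r) := by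
    ext c
    simp
  exact IsBaseChange.bijective_iff_lTensor S (IsBaseChange.linearMap R S)
    (FinitePresentation.isBaseChange_map R C C S) (f := LinearMap.lsmul R C) h

end BaseChange

/-- Base change of semidualizing modules along a flat ring homomorphism, and the
converse along a faithfully flat one. -/
theorem semidualizing_base_change_flat
    (R S : Type) [CommRing R] [CommRing S] [IsNoetherianRing R] [IsNoetherianRing S]
    [Algebra R S] [Module.Flat R S]
    (C : Type) [AddCommGroup C] [Module R C] [Module.Finite R C] :
    (IsSemidualizing R C → IsSemidualizing S (S ⊗[R] C)) ∧
      (Module.FaithfullyFlat R S → IsSemidualizing S (S ⊗[R] C) → IsSemidualizing R C) := by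
  have := Module.finitePresentation_of_finite R C
  have hExt (i : ℕ) := subsingleton_ext_baseChange (R := R) S C i C
  refine ⟨fun ⟨_, hbij, hC⟩ ↦ ⟨inferInstance, ?_, ?_⟩,
    fun _ ⟨_, hbij, hC⟩ ↦ ⟨inferInstance, ?_, ?_⟩⟩
  · exact (bijective_lsmul_baseChange_iff S C).2
      ((LinearEquiv.ofBijective _ hbij).lTensor S).bijective
  · rintro (_ | i) hi
    · simp at hi
    · exact (subsingleton_extMod_succ_iff _ _ i).2
        ((hExt i).1 ((subsingleton_extMod_succ_iff _ _ i).1 (hC _ hi)))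
  · exact (Module.FaithfullyFlat.lTensor_bijective_iff_bijective R S _).1
      ((bijective_lsmul_baseChange_iff S C).1 hbij)
  · rintro (_ | i) hi
    · simp at hi
    · exact (subsingleton_extMod_succ_iff _ _ i).2
        ((hExt i).2 inferInstance ((subsingleton_extMod_succ_iff _ _ i).1 (hC _ hi)))
end
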